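/- arXiv:2311.17226 — 3 statements merged into one kernel-verified Lean document; each statement's English description precedes it below -/
import Mathlib

section
/- Positivity of the variance constant in the supercritical regime: Let H(z) = Σ_{n≥0} h_n z^n be a power series with h_n ≥ 0 for all n and radius of convergence ρ_H > 0. Assume there are at least two indices n with h_n > 0, and at least one such index is ≥ 1. Let 0 < ρ < ρ_H, let q > 0, and set ρ_G := q·H(ρ). Then ρ_G²/(q² ρ² H′(ρ)²) − ρ_G/(q ρ H′(ρ)) + ρ_G² H″(ρ)/(q² ρ H′(ρ)³) > 0. (Consequently, in the supercritical regime q > q_c of the main theorem, the constant in the asymptotics σ_n²/n of the variance is strictly positive, so the Gaussian limit law is nondegenerate.) -/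
/-- Replace the terms of a convergent series by pointwise equal ones. -/
theorem HasSum.congr_terms {f g : ℕ → ℝ} {s : ℝ} (hf : HasSum f s) (hgf : ∀ n, g n = f n) :
    HasSum g s :=
  (funext hgf : g = f) ▸ hf

/-- Multiplying the coefficients of a power series by their index preserves summability inside
the disc of convergence. -/
theorem summable_natCast_mul_abs_mul_pow {c : ℕ → ℝ} {R r : ℝ}
    (hc : ∀ x : ℝ, |x| < R → Summable fun n : ℕ => c n * x ^ n) (hr : 0 ≤ r) (hrR : r < R) :
    Summable fun n : ℕ => (n : ℝ) * (|c n| * r ^ n) := by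
  obtain ⟨s, hrs, hsR⟩ := exists_between hrR
  have hs : 0 < s := hr.trans_lt hrs
  have htend := (hc s (by rwa [abs_of_pos hs])).tendsto_atTop_zero
  obtain ⟨M, hM⟩ := (Metric.isBounded_range_of_tendsto _ htend).exists_norm_le
  have hgeom : Summable fun n : ℕ => (n : ℝ) ^ 1 * (r / s) ^ n := by
    apply summable_pow_mul_geometric_of_norm_lt_one
    rw [Real.norm_of_nonneg (by positivity), div_lt_one hs]
    exact hrs
  refine Summable.of_nonneg_of_le (fun n => by positivity) (fun n => ?_) (hgeom.mul_left M)
  have hMn : |c n| * s ^ n ≤ M := by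
    have := hM _ ⟨n, rfl⟩
    rwa [Real.norm_eq_abs, abs_mul, abs_of_pos (pow_pos hs n)] at this
  calc (n : ℝ) * (|c n| * r ^ n) = (|c n| * s ^ n) * ((n : ℝ) ^ 1 * (r / s) ^ n) := by
        rw [div_pow]; field_simp
    _ ≤ M * ((n : ℝ) ^ 1 * (r / s) ^ n) := by gcongr

/-- The formal derivative of a real power series converges inside the disc of convergence. -/
theorem summable_succ_mul_mul_pow {c : ℕ → ℝ} {R : ℝ}
    (hc : ∀ x : ℝ, |x| < R → Summable fun n : ℕ => c n * x ^ n) (x : ℝ) (hx : |x| < R) :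
    Summable fun n : ℕ => ((n + 1 : ℝ) * c (n + 1)) * x ^ n := by
  obtain ⟨r, hxr, hrR⟩ := exists_between hx
  have hr : 0 < r := (abs_nonneg x).trans_lt hxr
  have hsum := ((summable_nat_add_iff 1).2
    (summable_natCast_mul_abs_mul_pow hc hr.le hrR)).mul_right r⁻¹
  refine Summable.of_norm_bounded hsum fun n => ?_
  have hpow : |x| ^ n ≤ r ^ n := by gcongr
  calc ‖((n + 1 : ℝ) * c (n + 1)) * x ^ n‖ = (n + 1 : ℝ) * |c (n + 1)| * |x| ^ n := by
        rw [Real.norm_eq_abs, abs_mul, abs_mul, abs_pow,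
          abs_of_nonneg (by positivity : (0 : ℝ) ≤ n + 1)]
    _ ≤ (n + 1 : ℝ) * |c (n + 1)| * r ^ n := by gcongr
    _ = ((n + 1 : ℕ) : ℝ) * (|c (n + 1)| * r ^ (n + 1)) * r⁻¹ := by
        push_cast; rw [pow_succ]; field_simp

/-- A real power series may be differentiated term by term inside its disc of convergence. -/
theorem hasDerivAt_tsum_mul_pow {c : ℕ → ℝ} {R : ℝ}
    (hc : ∀ x : ℝ, |x| < R → Summable fun n : ℕ => c n * x ^ n) (x : ℝ) (hx : |x| < R) :
    HasDerivAt (fun y : ℝ => ∑' n : ℕ, c n * y ^ n)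
      (∑' n : ℕ, ((n + 1 : ℝ) * c (n + 1)) * x ^ n) x := by
  obtain ⟨r, hxr, hrR⟩ := exists_between hx
  have hr : 0 < r := (abs_nonneg x).trans_lt hxr
  have hbound (n : ℕ) (y : ℝ) (hy : y ∈ Metric.ball (0 : ℝ) r) :
      ‖c n * (n * y ^ (n - 1))‖ ≤ (n : ℝ) * (|c n| * r ^ n) * r⁻¹ := by
    rw [mem_ball_zero_iff, Real.norm_eq_abs] at hy
    rcases n with _ | n
    · simp
    · have hpow : |y| ^ n ≤ r ^ n := by gcongr
      calc ‖c (n + 1) * ((n + 1 : ℕ) * y ^ (n + 1 - 1))‖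
          = ((n + 1 : ℕ) : ℝ) * |c (n + 1)| * |y| ^ n := by
            rw [Real.norm_eq_abs, abs_mul, abs_mul, abs_pow, Nat.abs_cast, Nat.add_sub_cancel]
            ring
        _ ≤ ((n + 1 : ℕ) : ℝ) * |c (n + 1)| * r ^ n := by gcongr
        _ = ((n + 1 : ℕ) : ℝ) * (|c (n + 1)| * r ^ (n + 1)) * r⁻¹ := by
            rw [pow_succ]; field_simp
  have hsum := (summable_natCast_mul_abs_mul_pow hc hr.le hrR).mul_right r⁻¹
  have hxball : x ∈ Metric.ball (0 : ℝ) r := by simpa using hxr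
  have hderiv := hasDerivAt_tsum_of_isPreconnected hsum Metric.isOpen_ball
    (convex_ball (0 : ℝ) r).isPreconnected
    (fun n y _ => (hasDerivAt_pow n y).const_mul (c n)) hbound hxball (hc x hx) hxball
  refine hderiv.congr_deriv ?_
  rw [(Summable.of_norm_bounded hsum fun n => hbound n x hxball).tsum_eq_zero_add]
  simp only [Nat.cast_zero, zero_mul, mul_zero, zero_add, Nat.add_sub_cancel, Nat.cast_add,
    Nat.cast_one]
  exact tsum_congr fun n => by ring

/-- Strict Cauchy–Schwarz inequality for the first two moments of a nonnegative weight on `ℕ`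
charging at least two points. -/
theorem sq_first_moment_lt {w : ℕ → ℝ} {A B D : ℝ} (hw : ∀ n, 0 ≤ w n)
    {a b : ℕ} (hab : a < b) (ha : 0 < w a) (hb : 0 < w b) (hA : HasSum w A)
    (hB : HasSum (fun n : ℕ => (n : ℝ) * w n) B)
    (hD : HasSum (fun n : ℕ => (n : ℝ) ^ 2 * w n) D) : B ^ 2 < A * D := by
  have hApos : 0 < A := ha.trans_le (le_hasSum hA a fun n _ => hw n)
  have hvar : HasSum (fun n : ℕ => w n * ((n : ℝ) * A - B) ^ 2)
      (A ^ 2 * D - 2 * A * B * B + B ^ 2 * A) := by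
    refine (((hD.mul_left (A ^ 2)).sub (hB.mul_left (2 * A * B))).add
      (hA.mul_left (B ^ 2))).congr_terms fun n => ?_
    ring
  have hnonneg (n : ℕ) : 0 ≤ w n * ((n : ℝ) * A - B) ^ 2 := mul_nonneg (hw n) (sq_nonneg _)
  have hpos : 0 < A ^ 2 * D - 2 * A * B * B + B ^ 2 * A := by
    by_cases hm : (a : ℝ) * A - B = 0
    · have hne : (b : ℝ) * A - B ≠ 0 := by
        have : (a : ℝ) * A < b * A := by gcongr
        linarith
      exact (by positivity : 0 < w b * ((b : ℝ) * A - B) ^ 2).trans_le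
        (le_hasSum hvar b fun n _ => hnonneg n)
    · exact (by positivity : 0 < w a * ((a : ℝ) * A - B) ^ 2).trans_le
        (le_hasSum hvar a fun n _ => hnonneg n)
  have hmul : 0 < A * (A * D - B ^ 2) := by linarith
  linarith [pos_of_mul_pos_right hmul hApos.le]


/-- **Positivity of the variance constant in the supercritical regime.**
Let `H(z) = ∑ h n z^n` have nonnegative coefficients and radius of convergence `ρH > 0`,
with at least two nonzero coefficients (so at least one of index `≥ 1`). For `0 < ρ < ρH`,
`q > 0` and `ρG := q H(ρ)`, the variance constant
`ρG²/(q²ρ²H′(ρ)²) − ρG/(qρH′(ρ)) + ρG²H″(ρ)/(q²ρH′(ρ)³)` is strictly positive. -/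
theorem supercritical_variance_constant_pos
    (h : ℕ → ℝ) (hh : ∀ n, 0 ≤ h n)
    (ρH : ℝ) (hρH : 0 < ρH)
    (hconv : ∀ x : ℝ, |x| < ρH → Summable (fun n : ℕ => h n * x ^ n))
    (hdiv : ∀ x : ℝ, ρH < x → ¬ Summable (fun n : ℕ => h n * x ^ n))
    (htwo : ∃ a b : ℕ, a < b ∧ 0 < h a ∧ 0 < h b)
    (ρ q : ℝ) (hρ : 0 < ρ) (hρρH : ρ < ρH) (hq : 0 < q)
    (H : ℝ → ℝ) (hH : H = fun x : ℝ => ∑' n : ℕ, h n * x ^ n)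
    (ρG : ℝ) (hρG : ρG = q * H ρ) :
    0 < ρG ^ 2 / (q ^ 2 * ρ ^ 2 * (deriv H ρ) ^ 2) - ρG / (q * ρ * deriv H ρ)
        + ρG ^ 2 * deriv (deriv H) ρ / (q ^ 2 * ρ * (deriv H ρ) ^ 3) := by
  have hρabs : |ρ| < ρH := by rwa [abs_of_pos hρ]
  have hconv₁ := summable_succ_mul_mul_pow hconv
  have hderiv (x : ℝ) (hx : |x| < ρH) :
      deriv H x = ∑' n : ℕ, ((n + 1 : ℝ) * h (n + 1)) * x ^ n := by
    rw [hH]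
    exact (hasDerivAt_tsum_mul_pow hconv x hx).deriv
  have hnear : deriv H =ᶠ[nhds ρ] fun x => ∑' n : ℕ, ((n + 1 : ℝ) * h (n + 1)) * x ^ n := by
    filter_upwards [(isOpen_lt continuous_abs continuous_const).mem_nhds hρabs] with x hx
      using hderiv x hx
  have hA : HasSum (fun n : ℕ => h n * ρ ^ n) (H ρ) := by
    rw [hH]
    exact (hconv ρ hρabs).hasSum
  have hB : HasSum (fun n : ℕ => (n : ℝ) * (h n * ρ ^ n)) (ρ * deriv H ρ) := by
    rw [← hasSum_nat_add_iff' 1, hderiv ρ hρabs]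
    simpa [pow_succ, mul_comm, mul_left_comm, mul_assoc] using
      (hconv₁ ρ hρabs).hasSum.mul_left ρ
  have hC : HasSum (fun n : ℕ => (n : ℝ) * (n - 1) * (h n * ρ ^ n))
      (ρ ^ 2 * deriv (deriv H) ρ) := by
    rw [← hasSum_nat_add_iff' 2, hnear.deriv_eq,
      (hasDerivAt_tsum_mul_pow hconv₁ ρ hρabs).deriv]
    simp only [Finset.sum_range_succ, Finset.sum_range_zero, Nat.cast_zero, Nat.cast_one, sub_self,
      zero_mul, mul_zero, add_zero, sub_zero]
    refine ((summable_succ_mul_mul_pow hconv₁ ρ hρabs).hasSum.mul_left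
      (ρ ^ 2)).congr_terms fun n => ?_
    push_cast
    ring
  have hD : HasSum (fun n : ℕ => (n : ℝ) ^ 2 * (h n * ρ ^ n))
      (ρ * deriv H ρ + ρ ^ 2 * deriv (deriv H) ρ) := by
    refine (hB.add hC).congr_terms fun n => ?_
    ring
  obtain ⟨a, b, hab, ha, hb⟩ := htwo
  have hw (n : ℕ) : 0 ≤ h n * ρ ^ n := mul_nonneg (hh n) (pow_pos hρ n).le
  have hcs := sq_first_moment_lt hw hab (by positivity) (by positivity) hA hB hD
  have hApos : 0 < H ρ :=
    (by positivity : 0 < h a * ρ ^ a).trans_le (le_hasSum hA a fun n _ => hw n)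
  have hbpos : (0 : ℝ) < b := by exact_mod_cast (Nat.zero_le a).trans_lt hab
  have hBpos : 0 < ρ * deriv H ρ :=
    (by positivity : 0 < (b : ℝ) * (h b * ρ ^ b)).trans_le
      (le_hasSum hB b fun n _ => mul_nonneg n.cast_nonneg (hw n))
  have hH'pos : 0 < deriv H ρ := pos_of_mul_pos_right hBpos hρ.le
  have key : ρG ^ 2 / (q ^ 2 * ρ ^ 2 * (deriv H ρ) ^ 2) - ρG / (q * ρ * deriv H ρ)
        + ρG ^ 2 * deriv (deriv H) ρ / (q ^ 2 * ρ * (deriv H ρ) ^ 3)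
      = H ρ * (H ρ * (ρ * deriv H ρ + ρ ^ 2 * deriv (deriv H) ρ) - (ρ * deriv H ρ) ^ 2)
        / (ρ * deriv H ρ) ^ 3 := by
    rw [hρG]
    field_simp
    ring
  rw [key]
  exact div_pos (mul_pos hApos (sub_pos.2 hcs)) (pow_pos hBpos 3)
end

section
/- Subcritical regime for fixed-point-biased 321-avoiding permutations: fix a real q with 0 < q < 3. Then for every integer k ≥ 0, lim_{n→∞} P(X_n(q) = k) = (k+1)·(1 − q/3)²·(q/3)^k; that is, X_n(q) converges in distribution to the negative binomial distribution NegBin(2, 1 − q/3). -/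
open Filter Topology

/-- A permutation `σ` of `{1,…,n}` avoids the pattern `321` if there are no indices
`i < j < k` with `σ i > σ j > σ k`. -/
def Avoids321 {n : ℕ} (σ : Equiv.Perm (Fin n)) : Prop :=
  ¬ ∃ i j k : Fin n, i < j ∧ j < k ∧ σ k < σ j ∧ σ j < σ i

/-- `av321FixedPointCount n k` is the number of `321`-avoiding permutations of `{1,…,n}`
with exactly `k` fixed points. -/
noncomputable def av321FixedPointCount (n k : ℕ) : ℕ :=
  Nat.card {σ : Equiv.Perm (Fin n) //
    Avoids321 σ ∧ (Finset.univ.filter fun i => σ i = i).card = k}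

namespace Av321

open Finset Equiv

/-- Insert the new maximum at position `p` into the one-line notation of `π`. -/
def insertMax {n : ℕ} (p : Fin (n + 1)) (π : Perm (Fin n)) : Perm (Fin (n + 1)) :=
  (finSuccEquiv' p).trans ((optionCongr π).trans (finSuccEquiv' (Fin.last n)).symm)

@[simp]
lemma insertMax_self {n : ℕ} (p : Fin (n + 1)) (π : Perm (Fin n)) :
    insertMax p π p = Fin.last n := by
  simp [insertMax]

@[simp]
lemma insertMax_succAbove {n : ℕ} (p : Fin (n + 1)) (π : Perm (Fin n)) (j : Fin n) :
    insertMax p π (p.succAbove j) = (π j).castSucc := by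
  simp [insertMax]

lemma insertMax_bijective (n : ℕ) :
    Function.Bijective (fun x : Fin (n + 1) × Perm (Fin n) => insertMax x.1 x.2) := by
  rw [Fintype.bijective_iff_injective_and_card]
  refine ⟨?_, by simp [Fintype.card_perm, Nat.factorial_succ]⟩
  rintro ⟨p, π⟩ ⟨p', π'⟩ h
  simp only at h
  have hp : p = p' := by
    apply (insertMax p' π').injective
    rw [insertMax_self, ← h, insertMax_self]
  subst hp
  congr 1
  ext j
  have := congrArg (fun σ => σ (p.succAbove j)) h
  simpa [Fin.ext_iff] using this

/-- The entries of `σ` at positions `≥ m` are increasing. -/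
def IncreasingFrom {n : ℕ} (m : ℕ) (σ : Perm (Fin n)) : Prop :=
  ∀ i j : Fin n, m ≤ i → i < j → σ i < σ j

lemma avoids321_insertMax {n : ℕ} (p : Fin (n + 1)) (π : Perm (Fin n)) :
    Avoids321 (insertMax p π) ↔ Avoids321 π ∧ IncreasingFrom p π := by
  constructor
  · intro h
    constructor
    · rintro ⟨i, j, k, hij, hjk, h1, h2⟩
      exact h ⟨p.succAbove i, p.succAbove j, p.succAbove k, by simpa, by simpa, by simpa, by simpa⟩
    · intro i j hi hij
      by_contra hlt
      have hne : π i ≠ π j := fun e => hij.ne (π.injective e)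
      refine h ⟨p, p.succAbove i, p.succAbove j, ?_, by simpa, ?_, ?_⟩
      · rw [Fin.lt_succAbove_iff_le_castSucc]
        exact hi
      · simpa using lt_of_le_of_ne (not_lt.1 hlt) hne.symm
      · simp [Fin.castSucc_lt_last]
  · rintro ⟨h, hinc⟩ ⟨i, j, k, hij, hjk, h1, h2⟩
    have hj : j ≠ p := by
      rintro rfl
      simp [(Fin.le_last _).not_gt] at h2
    have hk : k ≠ p := by
      rintro rfl
      simp [(Fin.le_last _).not_gt] at h1
    obtain ⟨j, rfl⟩ := Fin.exists_succAbove_eq hj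
    obtain ⟨k, rfl⟩ := Fin.exists_succAbove_eq hk
    simp only [insertMax_succAbove, Fin.castSucc_lt_castSucc_iff, Fin.succAbove_lt_succAbove_iff]
      at hjk h1
    by_cases hi : i = p
    · subst hi
      rw [Fin.lt_succAbove_iff_le_castSucc] at hij
      exact (hinc j k hij hjk).not_gt h1
    · obtain ⟨i, rfl⟩ := Fin.exists_succAbove_eq hi
      simp only [insertMax_succAbove, Fin.castSucc_lt_castSucc_iff,
        Fin.succAbove_lt_succAbove_iff] at hij h2
      exact h ⟨i, j, k, hij, hjk, h1, h2⟩

lemma increasingFrom_insertMax_last {n m : ℕ} (π : Perm (Fin n)) :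
    IncreasingFrom m (insertMax (Fin.last n) π) ↔ IncreasingFrom m π := by
  constructor
  · intro h i j hi hij
    have := h ((Fin.last n).succAbove i) ((Fin.last n).succAbove j) (by simpa using hi) (by simpa)
    simpa only [insertMax_succAbove, Fin.castSucc_lt_castSucc_iff] using this
  · intro h i j hi hij
    have hil : i ≠ Fin.last n := (hij.trans_le (Fin.le_last j)).ne
    obtain ⟨i, rfl⟩ := Fin.exists_succAbove_eq hil
    by_cases hj : j = Fin.last n
    · rw [hj, insertMax_self, insertMax_succAbove]
      exact Fin.castSucc_lt_last _
    · obtain ⟨j, rfl⟩ := Fin.exists_succAbove_eq hj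
      simp only [insertMax_succAbove, Fin.castSucc_lt_castSucc_iff, Fin.succAbove_lt_succAbove_iff]
        at hij ⊢
      exact h i j (by simpa using hi) hij

lemma increasingFrom_insertMax {n m : ℕ} {p : Fin (n + 1)} (hp : p ≠ Fin.last n)
    {π : Perm (Fin n)} (hπ : IncreasingFrom p π) :
    IncreasingFrom m (insertMax p π) ↔ (p : ℕ) < m := by
  constructor
  · intro h
    by_contra! hm
    have := h p (Fin.last n) hm (Fin.lt_last_iff_ne_last.2 hp)
    simp [(Fin.le_last _).not_gt] at this
  · intro hm i j hi hij
    have hpi : p < i := Fin.lt_def.2 (hm.trans_le hi)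
    obtain ⟨i, rfl⟩ := Fin.exists_succAbove_eq hpi.ne'
    obtain ⟨j, rfl⟩ := Fin.exists_succAbove_eq (hpi.trans hij).ne'
    rw [Fin.lt_succAbove_iff_le_castSucc] at hpi
    simp only [insertMax_succAbove, Fin.castSucc_lt_castSucc_iff, Fin.succAbove_lt_succAbove_iff]
      at hij ⊢
    exact hπ i j hpi hij

open Classical in
/-- The number of `321`-avoiding permutations whose entries at positions `≥ m` are increasing. -/
noncomputable def incCount (n m : ℕ) : ℕ :=
  #{σ : Perm (Fin n) | Avoids321 σ ∧ IncreasingFrom m σ}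

lemma incCount_succ {n m : ℕ} (hm : m ≤ n) :
    incCount (n + 1) m = incCount n m + ∑ p ∈ range m, incCount n p := by
  classical
  have key : incCount (n + 1) m = ∑ p : Fin (n + 1),
      #{π : Perm (Fin n) | Avoids321 (insertMax p π) ∧ IncreasingFrom m (insertMax p π)} := by
    rw [incCount, ← Fintype.card_subtype, ← Fintype.card_congr
      ((Equiv.ofBijective _ (insertMax_bijective n)).subtypeEquiv
        (p := fun x => Avoids321 (insertMax x.1 x.2) ∧ IncreasingFrom m (insertMax x.1 x.2))
        (fun _ => Iff.rfl)), Fintype.card_subtype, ← univ_product_univ, card_filter, sum_product]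
    simp_rw [card_filter]
  have hlast : #{π : Perm (Fin n) | Avoids321 (insertMax (Fin.last n) π) ∧
      IncreasingFrom m (insertMax (Fin.last n) π)} = incCount n m := by
    rw [incCount]
    congr 1
    ext π
    simp only [mem_filter, mem_univ, true_and, avoids321_insertMax, increasingFrom_insertMax_last]
    refine ⟨fun h => ⟨h.1.1, h.2⟩, fun h => ⟨⟨h.1, fun i j hi => ?_⟩, h.2⟩⟩
    exact absurd i.2 (not_lt.2 (by simpa using hi))
  have hne (p : Fin n) : #{π : Perm (Fin n) | Avoids321 (insertMax p.castSucc π) ∧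
      IncreasingFrom m (insertMax p.castSucc π)} = if (p : ℕ) < m then incCount n p else 0 := by
    have hiff (π : Perm (Fin n)) : (Avoids321 (insertMax p.castSucc π) ∧
        IncreasingFrom m (insertMax p.castSucc π)) ↔
        (p : ℕ) < m ∧ Avoids321 π ∧ IncreasingFrom p π := by
      rw [avoids321_insertMax]
      constructor
      · rintro ⟨⟨h1, h2⟩, h3⟩
        exact ⟨(increasingFrom_insertMax (Fin.castSucc_ne_last p) h2).1 h3, h1, h2⟩
      · rintro ⟨h3, h1, h2⟩
        exact ⟨⟨h1, h2⟩, (increasingFrom_insertMax (Fin.castSucc_ne_last p) h2).2 h3⟩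
    simp_rw [hiff]
    split_ifs with h
    · simp [h, incCount]
    · simp [h]
  rw [key, Fin.sum_univ_castSucc, hlast, add_comm]
  simp_rw [hne]
  rw [Fin.sum_univ_eq_sum_range (fun p => if p < m then incCount n p else 0) n, ← sum_filter]
  congr 2
  ext x
  simp
  omega

lemma incCount_eq_of_le {n m m' : ℕ} (hm : n ≤ m + 1) (hm' : n ≤ m' + 1) :
    incCount n m = incCount n m' := by
  have h {l : ℕ} (hl : n ≤ l + 1) (σ : Perm (Fin n)) : IncreasingFrom l σ := by
    intro i j hi hij
    have := j.2
    have : (i : ℕ) < j := hij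
    omega
  classical
  exact congrArg card (filter_congr fun σ _ => by simp only [h hm, h hm'])

/-- Ballot numbers. -/
def ballot (n m : ℕ) : ℤ := (n + m).choose n - (n + m).choose (n + 1)

lemma ballot_succ_succ (n m : ℕ) : ballot (n + 1) (m + 1) = ballot (n + 1) m + ballot n (m + 1) := by
  have h1 : n + 1 + (m + 1) = (n + m + 1) + 1 := by ring
  have h2 : n + 1 + m = n + m + 1 := by ring
  have h3 : n + (m + 1) = n + m + 1 := by ring
  simp only [ballot, h1, h2, h3, Nat.choose_succ_succ' (n + m + 1)]
  push_cast
  ring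

lemma ballot_succ (n m : ℕ) : ballot (n + 1) m = ballot n m + ∑ p ∈ range m, ballot n p := by
  induction m with
  | zero => simp [ballot]
  | succ m ih => rw [ballot_succ_succ, ih, sum_range_succ]; ring

lemma ballot_self_succ (n : ℕ) : ballot n (n + 1) = 0 := by
  have : (n + (n + 1)).choose n = (n + (n + 1)).choose (n + 1) := Nat.choose_symm_add
  simp [ballot, this]

lemma ballot_self (n : ℕ) : ballot n n = catalan n := by
  have h1 := Nat.choose_succ_right_eq (n + n) n
  have h2 := succ_mul_catalan_eq_centralBinom n
  rw [Nat.centralBinom, two_mul] at h2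
  rw [Nat.add_sub_cancel] at h1
  zify at h1 h2
  have : (n + 1 : ℤ) ≠ 0 := by positivity
  apply mul_left_cancel₀ this
  rw [h2, ballot]
  linear_combination -h1

lemma incCount_eq_ballot {n m : ℕ} (hm : m ≤ n) : (incCount n m : ℤ) = ballot n m := by
  induction n generalizing m with
  | zero =>
    obtain rfl : m = 0 := by omega
    have : IncreasingFrom 0 (1 : Perm (Fin 0)) := fun i => i.elim0
    have h' : Avoids321 (1 : Perm (Fin 0)) := fun ⟨i, _⟩ => i.elim0
    simp [incCount, ballot, Subsingleton.elim _ (1 : Perm (Fin 0)), this, h', Finset.filter_true_of_mem]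
  | succ n ih =>
    have h {m : ℕ} (hm : m ≤ n) : (incCount (n + 1) m : ℤ) = ballot (n + 1) m := by
      rw [incCount_succ hm, ballot_succ]
      push_cast
      rw [ih hm]
      congr 1
      exact sum_congr rfl fun p hp => ih (by simp at hp; omega)
    rcases hm.lt_or_eq with hm | rfl
    · exact h (by omega)
    · rw [incCount_eq_of_le (m' := n) (by omega) le_rfl, h le_rfl, ballot_succ_succ,
        ballot_self_succ, add_zero]

open Classical in
/-- The `321`-avoiding permutations of `{1,…,n}`. -/
noncomputable def av (n : ℕ) : Finset (Perm (Fin n)) := {σ | Avoids321 σ}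

lemma card_av (n : ℕ) : #(av n) = catalan n := by
  have h := incCount_eq_ballot (le_refl n)
  rw [ballot_self] at h
  have h' (σ : Perm (Fin n)) : IncreasingFrom n σ := fun i j hi _ => absurd i.2 (by omega)
  rw [← Nat.cast_inj (R := ℤ), ← h, av, incCount]
  congr 2
  ext σ
  simp [h']

/-- The number of fixed points of `σ`. -/
def fixCount {n : ℕ} (σ : Perm (Fin n)) : ℕ := #{i | σ i = i}

/-- The direct sum `σ ⊕ 1 ⊕ τ`. -/
def joinFixed {a b : ℕ} (σ : Perm (Fin a)) (τ : Perm (Fin b)) : Perm (Fin (a + (b + 1))) :=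
  finSumFinEquiv.permCongr (Perm.sumCongr σ (Perm.decomposeFin.symm (0, τ)))

section joinFixed

variable {a b : ℕ} (σ : Perm (Fin a)) (τ : Perm (Fin b))

@[simp]
lemma joinFixed_castAdd (i : Fin a) :
    joinFixed σ τ (Fin.castAdd (b + 1) i) = Fin.castAdd (b + 1) (σ i) := by
  simp [joinFixed, permCongr_apply]

@[simp]
lemma joinFixed_natAdd_zero :
    joinFixed σ τ (Fin.natAdd a 0) = Fin.natAdd a 0 := by
  simp [joinFixed, permCongr_apply]

@[simp]
lemma joinFixed_natAdd_succ (j : Fin b) :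
    joinFixed σ τ (Fin.natAdd a j.succ) = Fin.natAdd a (τ j).succ := by
  simp [joinFixed, permCongr_apply]

lemma fixCount_joinFixed : fixCount (joinFixed σ τ) = fixCount σ + (fixCount τ + 1) := by
  simp only [fixCount, card_filter, Fin.sum_univ_add, Fin.sum_univ_succ, joinFixed_castAdd,
    joinFixed_natAdd_zero, joinFixed_natAdd_succ, Fin.castAdd_inj, Fin.natAdd_inj, Fin.succ_inj]
  simp [add_comm]

lemma avoids321_joinFixed : Avoids321 (joinFixed σ τ) ↔ Avoids321 σ ∧ Avoids321 τ := by
  constructor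
  · intro h
    constructor
    · rintro ⟨i, j, k, hij, hjk, h1, h2⟩
      refine h ⟨Fin.castAdd _ i, Fin.castAdd _ j, Fin.castAdd _ k, ?_⟩
      simpa using ⟨hij, hjk, h1, h2⟩
    · rintro ⟨i, j, k, hij, hjk, h1, h2⟩
      refine h ⟨Fin.natAdd _ i.succ, Fin.natAdd _ j.succ, Fin.natAdd _ k.succ, ?_⟩
      simpa using ⟨hij, hjk, h1, h2⟩
  · rintro ⟨hσ, hτ⟩ ⟨i, j, k, hij, hjk, h1, h2⟩
    have hcases (x : Fin (a + (b + 1))) : (∃ y, x = Fin.castAdd _ y) ∨ x = Fin.natAdd a 0 ∨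
        ∃ y : Fin b, x = Fin.natAdd a y.succ := by
      induction x using Fin.addCases with
      | left y => exact Or.inl ⟨y, rfl⟩
      | right y =>
        induction y using Fin.cases with
        | zero => exact Or.inr (Or.inl rfl)
        | succ y => exact Or.inr (Or.inr ⟨y, rfl⟩)
    rcases hcases i with ⟨i, rfl⟩ | rfl | ⟨i, rfl⟩ <;>
    rcases hcases k with ⟨k, rfl⟩ | rfl | ⟨k, rfl⟩ <;>
    rcases hcases j with ⟨j, rfl⟩ | rfl | ⟨j, rfl⟩ <;>
    simp only [joinFixed_castAdd, joinFixed_natAdd_zero, joinFixed_natAdd_succ, Fin.lt_def,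
      Fin.val_castAdd, Fin.val_natAdd, Fin.val_succ, Fin.val_zero] at hij hjk h1 h2 <;>
    first
    | omega
    | exact hσ ⟨i, j, k, hij, hjk, h1, h2⟩
    | exact hτ ⟨i, j, k, Fin.lt_def.2 (by omega), Fin.lt_def.2 (by omega),
        Fin.lt_def.2 (by omega), Fin.lt_def.2 (by omega)⟩

lemma joinFixed_injective :
    Function.Injective (fun x : Perm (Fin a) × Perm (Fin b) => joinFixed x.1 x.2) := by
  rintro ⟨σ, τ⟩ ⟨σ', τ'⟩ h
  simp only at h
  have h1 : σ = σ' := Equiv.ext fun i => by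
    simpa using congrArg (fun ρ => ρ (Fin.castAdd _ i)) h
  have h2 : τ = τ' := Equiv.ext fun i => by
    simpa using congrArg (fun ρ => ρ (Fin.natAdd a i.succ)) h
  rw [h1, h2]

lemma exists_joinFixed_eq {ρ : Perm (Fin (a + (b + 1)))} (hρ : Avoids321 ρ)
    (hfix : ρ (Fin.natAdd a 0) = Fin.natAdd a 0) :
    ∃ (σ : Perm (Fin a)) (τ : Perm (Fin b)), joinFixed σ τ = ρ := by
  set ρ' : Perm (Fin a ⊕ Fin (b + 1)) := finSumFinEquiv.symm.permCongr ρ with hρ'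
  have hρρ' : finSumFinEquiv.permCongr ρ' = ρ := by
    ext x
    simp [hρ', permCongr_apply]
  have hval (x) : finSumFinEquiv (ρ' x) = ρ (finSumFinEquiv x) := by
    simp [hρ', permCongr_apply]
  have hmaps : Set.MapsTo ρ' (Set.range Sum.inl) (Set.range Sum.inl) := by
    by_contra hl
    have hr := mt (Perm.perm_mapsTo_inl_iff_mapsTo_inr ρ').2 hl
    simp only [Set.MapsTo, Set.mem_range, not_forall] at hl hr
    obtain ⟨_, ⟨i, rfl⟩, hi⟩ := hl
    obtain ⟨_, ⟨k, rfl⟩, hk⟩ := hr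
    have hvi := hval (Sum.inl i)
    have hvk := hval (Sum.inr k)
    rcases hi' : ρ' (Sum.inl i) with u | u
    · exact hi ⟨u, hi'.symm⟩
    rcases hk' : ρ' (Sum.inr k) with v | v
    swap
    · exact hk ⟨v, hk'.symm⟩
    rw [hi', finSumFinEquiv_apply_left, finSumFinEquiv_apply_right] at hvi
    rw [hk', finSumFinEquiv_apply_left, finSumFinEquiv_apply_right] at hvk
    have hk0 : k ≠ 0 := by
      rintro rfl
      rw [hfix] at hvk
      have := congrArg Fin.val hvk
      simp at this
      omega
    have hu0 : u ≠ 0 := by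
      rintro rfl
      rw [← hfix] at hvi
      have := congrArg Fin.val (ρ.injective hvi)
      simp at this
      omega
    refine hρ ⟨Fin.castAdd _ i, Fin.natAdd a 0, Fin.natAdd a k, ?_, ?_, ?_, ?_⟩
    · exact Fin.lt_def.2 (by simp)
    · simpa using Fin.pos_iff_ne_zero.2 hk0
    · rw [hfix, ← hvk]
      exact Fin.lt_def.2 (by simp)
    · rw [hfix, ← hvi]
      simpa using Fin.pos_iff_ne_zero.2 hu0
  obtain ⟨⟨σ, τ'⟩, h⟩ := Perm.mem_sumCongrHom_range_of_perm_mapsTo_inl hmaps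
  obtain ⟨⟨p, τ⟩, rfl⟩ := Perm.decomposeFin.symm.surjective τ'
  have hp : p = 0 := by
    have := hval (Sum.inr 0)
    rw [finSumFinEquiv_apply_right, hfix, ← h] at this
    simpa using this
  subst hp
  exact ⟨σ, τ, by rw [← hρρ', ← h]; rfl⟩

/-- The first fixed point of `σ` is at position `a`. -/
def FirstFixedAt {n : ℕ} (σ : Perm (Fin n)) (a : ℕ) : Prop :=
  ∃ h : a < n, σ ⟨a, h⟩ = ⟨a, h⟩ ∧ ∀ i : Fin n, (i : ℕ) < a → σ i ≠ i

lemma firstFixedAt_joinFixed : FirstFixedAt (joinFixed σ τ) a ↔ fixCount σ = 0 := by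
  have h0 : (⟨a, by omega⟩ : Fin (a + (b + 1))) = Fin.natAdd a 0 := rfl
  rw [fixCount, card_eq_zero, filter_eq_empty_iff]
  constructor
  · rintro ⟨_, _, h⟩ i _ hi
    exact h (Fin.castAdd _ i) i.2 (by simp [hi])
  · intro h
    refine ⟨by omega, by rw [h0, joinFixed_natAdd_zero], fun i hi => ?_⟩
    obtain ⟨i, rfl⟩ : ∃ j, i = Fin.castAdd _ j := ⟨⟨i, hi⟩, rfl⟩
    simpa using h (mem_univ i)

end joinFixed

lemma FirstFixedAt.eq {n a a' : ℕ} {σ : Perm (Fin n)} (h : FirstFixedAt σ a)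
    (h' : FirstFixedAt σ a') : a = a' := by
  obtain ⟨ha, h1, h2⟩ := h
  obtain ⟨ha', h1', h2'⟩ := h'
  rcases lt_trichotomy a a' with hlt | rfl | hlt
  · exact absurd h1 (h2' _ hlt)
  · rfl
  · exact absurd h1' (h2 _ hlt)

lemma exists_firstFixedAt_iff {n : ℕ} {σ : Perm (Fin n)} :
    (∃ a, FirstFixedAt σ a) ↔ fixCount σ ≠ 0 := by
  rw [fixCount, Ne, card_eq_zero, ← Ne, ← nonempty_iff_ne_empty]
  constructor
  · rintro ⟨a, ha, h, -⟩
    exact ⟨⟨a, ha⟩, by simpa⟩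
  · intro h
    have hmin := min'_mem _ h
    refine ⟨_, (min' _ h).2, (mem_filter.1 hmin).2, fun i hi hfix => ?_⟩
    exact (min'_le _ i (by simpa using hfix)).not_gt hi

open Polynomial in
/-- The fixed point enumerator of the `321`-avoiding permutations of `{1,…,n}`. -/
noncomputable def fixPoly (n : ℕ) : ℝ[X] := ∑ σ ∈ av n, X ^ fixCount σ

/-- The number of `321`-avoiding derangements of `{1,…,n}`. -/
noncomputable def derCount (n : ℕ) : ℕ := #{σ ∈ av n | fixCount σ = 0}

open Polynomial in
open Classical in
lemma sum_av_firstFixedAt (a b : ℕ) :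
    ∑ ρ ∈ av (a + b + 1) with FirstFixedAt ρ a, (X ^ fixCount ρ : ℝ[X]) =
      X * ((derCount a : ℝ[X]) * fixPoly b) := by
  have h : ∑ ρ ∈ av (a + (b + 1)) with FirstFixedAt ρ a, (X ^ fixCount ρ : ℝ[X]) =
      ∑ x ∈ {σ ∈ av a | fixCount σ = 0} ×ˢ av b, X * X ^ fixCount x.2 := by
    symm
    refine sum_nbij (fun x => joinFixed x.1 x.2) ?_ joinFixed_injective.injOn ?_ ?_
    · rintro ⟨σ, τ⟩ h
      simp only [mem_product, mem_filter, av, mem_univ, true_and] at h ⊢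
      exact ⟨(avoids321_joinFixed σ τ).2 ⟨h.1.1, h.2⟩, (firstFixedAt_joinFixed σ τ).2 h.1.2⟩
    · intro ρ hρ
      simp only [mem_coe, mem_filter, av, mem_univ, true_and] at hρ
      obtain ⟨σ, τ, rfl⟩ := exists_joinFixed_eq hρ.1 hρ.2.2.1
      rw [avoids321_joinFixed, firstFixedAt_joinFixed] at hρ
      refine ⟨(σ, τ), ?_, rfl⟩
      simp only [coe_product, Set.mem_prod, mem_coe, mem_filter, av, mem_univ, true_and]
      exact ⟨⟨hρ.1.1, hρ.2⟩, hρ.1.2⟩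
    · rintro ⟨σ, τ⟩ h
      simp only [mem_product, mem_filter] at h
      simp only [fixCount_joinFixed, h.1.2]
      ring
  rw [add_assoc, h, sum_product, derCount, fixPoly]
  simp [← mul_sum]
  ring

open Polynomial in
lemma fixPoly_succ (n : ℕ) :
    fixPoly (n + 1) = (derCount (n + 1) : ℝ[X]) +
      X * ∑ p ∈ antidiagonal n, (derCount p.1 : ℝ[X]) * fixPoly p.2 := by
  classical
  have hsplit (σ : Perm (Fin (n + 1))) : (X ^ fixCount σ : ℝ[X]) =
      (if fixCount σ = 0 then 1 else 0) +
        ∑ p ∈ antidiagonal n, if FirstFixedAt σ p.1 then X ^ fixCount σ else 0 := by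
    rw [Nat.sum_antidiagonal_eq_sum_range_succ_mk]
    by_cases h : fixCount σ = 0
    · have h' (a : ℕ) : ¬ FirstFixedAt σ a := fun ha =>
        exists_firstFixedAt_iff.1 ⟨a, ha⟩ h
      simp [h, h']
    · obtain ⟨a, ha⟩ := exists_firstFixedAt_iff.2 h
      have h' (a' : ℕ) : FirstFixedAt σ a' ↔ a = a' := ⟨ha.eq, fun e => e ▸ ha⟩
      simp [h, h', ha.1]
  rw [fixPoly, sum_congr rfl fun σ _ => hsplit σ, sum_add_distrib, sum_comm, mul_sum]
  congr 1
  · simp [derCount]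
  · refine sum_congr rfl fun p hp => ?_
    obtain ⟨a, b⟩ := p
    obtain rfl := mem_antidiagonal.1 hp
    rw [← sum_filter, sum_av_firstFixedAt]

lemma eval_one_fixPoly (n : ℕ) : (fixPoly n).eval 1 = catalan n := by
  simp [fixPoly, Polynomial.eval_finsetSum, card_av]

lemma fixPoly_zero : fixPoly 0 = 1 := by
  have h : #(av 0) = 1 := by rw [card_av, catalan_zero]
  have h' (σ : Perm (Fin 0)) : fixCount σ = 0 := by simp [fixCount]
  simp [fixPoly, h', h]

lemma derCount_zero : derCount 0 = 1 := by
  have h : #(av 0) = 1 := by rw [card_av, catalan_zero]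
  have h' (σ : Perm (Fin 0)) : fixCount σ = 0 := by simp [fixCount]
  simp [derCount, h', h]

lemma coeff_fixPoly (n k : ℕ) : (fixPoly n).coeff k = av321FixedPointCount n k := by
  classical
  have : av321FixedPointCount n k = #{σ ∈ av n | k = fixCount σ} := by
    rw [av321FixedPointCount, Nat.card_eq_fintype_card, Fintype.card_subtype, av, filter_filter]
    simp only [fixCount, eq_comm]
  rw [this]
  simp [fixPoly, Polynomial.coeff_X_pow]

section PowerSeries

open Polynomial PowerSeries

lemma catalan_succ_eq_derCount (n : ℕ) : (catalan (n + 1) : ℝ[X]) =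
    derCount (n + 1) + ∑ p ∈ HasAntidiagonal.antidiagonal n,
      (derCount p.1 : ℝ[X]) * (catalan p.2 : ℝ[X]) := by
  have h := congrArg (Polynomial.eval 1) (fixPoly_succ n)
  simp only [eval_one_fixPoly, Polynomial.eval_add, Polynomial.eval_mul, Polynomial.eval_natCast,
    Polynomial.eval_finsetSum, Polynomial.eval_X, one_mul] at h
  exact_mod_cast h

lemma exists_fixPoly_series : ∃ A K : PowerSeries ℝ[X],
    (∀ n, PowerSeries.coeff n K = (catalan n : ℝ[X])) ∧ K = 1 + PowerSeries.X * K ^ 2 ∧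
    K = A + PowerSeries.X * (A * K) ∧
    PowerSeries.mk fixPoly =
      A + PowerSeries.C (Polynomial.X : ℝ[X]) * (PowerSeries.X * (A * PowerSeries.mk fixPoly)) := by
  refine ⟨PowerSeries.mk fun n => (derCount n : ℝ[X]), PowerSeries.mk fun n => (catalan n : ℝ[X]),
    fun n => PowerSeries.coeff_mk _ _, ?_, ?_, ?_⟩
  · ext1 n
    cases n with
    | zero => simp [PowerSeries.coeff_zero_eq_constantCoeff]
    | succ n =>
      rw [map_add, PowerSeries.coeff_succ_X_mul]
      simp [sq, PowerSeries.coeff_mul, PowerSeries.coeff_one,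
        catalan_succ']
  · ext1 n
    cases n with
    | zero => simp [derCount_zero]
    | succ n =>
      rw [map_add, PowerSeries.coeff_succ_X_mul, PowerSeries.coeff_mul]
      simp only [PowerSeries.coeff_mk]
      exact catalan_succ_eq_derCount n
  · ext1 n
    cases n with
    | zero => simp [fixPoly_zero, derCount_zero]
    | succ n =>
      rw [map_add, PowerSeries.coeff_C_mul, PowerSeries.coeff_succ_X_mul, PowerSeries.coeff_mul]
      simp only [PowerSeries.coeff_mk]
      exact fixPoly_succ n

lemma fixPoly_recurrences (n : ℕ) :
    (2 - Polynomial.X) * fixPoly (n + 1) + (1 - Polynomial.X) ^ 2 * fixPoly n =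
      (catalan (n + 1) : ℝ[X]) ∧
    fixPoly (n + 1) = (Polynomial.X - 1) * fixPoly n +
      ∑ p ∈ HasAntidiagonal.antidiagonal n, (catalan p.1 : ℝ[X]) * fixPoly p.2 := by
  obtain ⟨A, K, hK, hK1, hK2, hF⟩ := exists_fixPoly_series
  set F := PowerSeries.mk fixPoly with hFdef
  set x : PowerSeries ℝ[X] := PowerSeries.X
  set q : PowerSeries ℝ[X] := PowerSeries.C Polynomial.X with hq
  have hFU : F * (1 + (1 - q) * x * K) = K := by
    linear_combination (1 + x * K) * hF + (-1 - q * x * F) * hK2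
  have hU : 1 + (1 - q) * x * K ≠ 0 := by
    intro h
    have := congrArg PowerSeries.constantCoeff h
    simp [x] at this
  have hK0 : K ≠ 0 := by
    intro h
    have := hK 0
    simp [h] at this
  have h1 : (2 - q) * F + (1 - q) ^ 2 * (x * F) = (1 - q) + K := by
    apply mul_right_cancel₀ hU
    linear_combination ((2 - q) + (1 - q) ^ 2 * x) * hFU + (1 - q) * hK1
  have h2 : F = 1 + x * ((q - 1) * F + K * F) := by
    apply mul_left_cancel₀ hK0
    linear_combination hFU + F * hK1
  constructor
  · have h := congrArg (PowerSeries.coeff (n + 1)) h1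
    have e1 : (2 - q : PowerSeries ℝ[X]) = PowerSeries.C (2 - Polynomial.X) := by
      rw [map_sub, map_ofNat]
    have e2 : ((1 - q) ^ 2 : PowerSeries ℝ[X]) = PowerSeries.C ((1 - Polynomial.X) ^ 2) := by
      simp [hq]
    have e3 : (1 - q : PowerSeries ℝ[X]) = PowerSeries.C (1 - Polynomial.X) := by
      simp [hq]
    rw [e1, e2, e3, map_add, map_add, PowerSeries.coeff_C_mul, PowerSeries.coeff_C_mul,
      PowerSeries.coeff_succ_X_mul, PowerSeries.coeff_C, if_neg n.succ_ne_zero, zero_add, hK,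
      PowerSeries.coeff_mk, PowerSeries.coeff_mk] at h
    exact h
  · have h := congrArg (PowerSeries.coeff (n + 1)) h2
    have e1 : (q - 1 : PowerSeries ℝ[X]) = PowerSeries.C (Polynomial.X - 1) := by
      simp [hq]
    rw [e1, map_add, PowerSeries.coeff_succ_X_mul, map_add, PowerSeries.coeff_C_mul,
      PowerSeries.coeff_mul, PowerSeries.coeff_one, if_neg n.succ_ne_zero, zero_add] at h
    simpa only [hFdef, PowerSeries.coeff_mk, hK] using h

end PowerSeries

lemma catalan_succ_mul (n : ℕ) : ((n : ℝ) + 2) * catalan (n + 1) = 2 * (2 * n + 1) * catalan n := by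
  have h1 := succ_mul_catalan_eq_centralBinom n
  have h2 := succ_mul_catalan_eq_centralBinom (n + 1)
  have h3 := Nat.succ_mul_centralBinom_succ n
  rw [← h1, ← h2] at h3
  have h4 : ((n : ℝ) + 1) ≠ 0 := by positivity
  apply mul_left_cancel₀ h4
  have h5 : ((n : ℝ) + 1) * ((n + 1 + 1) * catalan (n + 1)) =
      2 * (2 * n + 1) * ((n + 1) * catalan n) := by exact_mod_cast h3
  linear_combination h5

lemma catalan_pos (n : ℕ) : (0 : ℝ) < catalan n := by
  have h := succ_mul_catalan_eq_centralBinom n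
  have := Nat.centralBinom_pos n
  rw [← h] at this
  exact_mod_cast Nat.pos_of_mul_pos_left this

lemma catalan_succ_le (n : ℕ) : (catalan (n + 1) : ℝ) ≤ 4 * catalan n := by
  have h := catalan_succ_mul n
  have h0 := catalan_pos n
  have h2 : (0 : ℝ) < n + 2 := by positivity
  refine le_of_mul_le_mul_left ?_ h2
  rw [h]
  nlinarith

lemma tendsto_catalan_ratio :
    Tendsto (fun n => (catalan n : ℝ) / catalan (n + 1)) atTop (𝓝 (1 / 4)) := by
  have h (n : ℕ) : (catalan n : ℝ) / catalan (n + 1) = 1 / 4 + 3 / 8 * (1 / ((n : ℝ) + 1 / 2)) := by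
    have h := catalan_succ_mul n
    have h0 := catalan_pos (n + 1)
    have h2 : (n : ℝ) + 1 / 2 ≠ 0 := by positivity
    rw [div_eq_iff h0.ne']
    field_simp
    linear_combination -16 * h
  simp_rw [h]
  have h1 : Tendsto (fun n : ℕ => 1 / ((n : ℝ) + 1 / 2)) atTop (𝓝 0) :=
    tendsto_const_nhds.div_atTop (tendsto_natCast_atTop_atTop.atTop_add tendsto_const_nhds)
  simpa using tendsto_const_nhds.add (h1.const_mul (3 / 8))

lemma sum_catalan_div_four_pow (n : ℕ) :
    ∑ i ∈ range n, (catalan i : ℝ) / 4 ^ i = 2 - 2 * (n + 1) * (catalan n / 4 ^ n) := by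
  induction n with
  | zero => simp
  | succ n ih =>
    rw [sum_range_succ, ih]
    have h := catalan_succ_mul n
    push_cast
    field_simp
    linear_combination 2 * 4 ^ n * h

lemma sum_catalan_div_four_pow_le (n : ℕ) : ∑ i ∈ range n, (catalan i : ℝ) / 4 ^ i ≤ 2 := by
  rw [sum_catalan_div_four_pow]
  have := catalan_pos n
  have : 0 ≤ 2 * ((n : ℝ) + 1) * (catalan n / 4 ^ n) := by positivity
  linarith

lemma eval_fixPoly_nonneg {r : ℝ} (hr : 0 ≤ r) (n : ℕ) : 0 ≤ (fixPoly n).eval r := by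
  simp only [fixPoly, Polynomial.eval_finsetSum, Polynomial.eval_pow, Polynomial.eval_X]
  positivity

/-- Exponential growth rate bound from the renewal equation. -/
lemma eval_fixPoly_le_four_pow {r : ℝ} (hr1 : 1 ≤ r) (hr3 : r ≤ 3) (n : ℕ) :
    (fixPoly n).eval r ≤ 4 ^ n := by
  induction n using Nat.strong_induction_on with
  | _ n ih =>
    cases n with
    | zero => simp [fixPoly_zero]
    | succ n =>
      rw [(fixPoly_recurrences n).2]
      simp only [Polynomial.eval_add, Polynomial.eval_mul, Polynomial.eval_sub, Polynomial.eval_X,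
        Polynomial.eval_one, Polynomial.eval_finsetSum, Polynomial.eval_natCast]
      have hsum : ∑ p ∈ HasAntidiagonal.antidiagonal n,
          (catalan p.1 : ℝ) * (fixPoly p.2).eval r ≤ 2 * 4 ^ n := by
        calc _ ≤ ∑ p ∈ HasAntidiagonal.antidiagonal n, (catalan p.1 : ℝ) / 4 ^ p.1 * 4 ^ n := by
              refine sum_le_sum fun p hp => ?_
              have hp := mem_antidiagonal.1 hp
              rw [← hp, pow_add, ← mul_assoc, div_mul_cancel₀ _ (by positivity)]
              exact mul_le_mul_of_nonneg_left (ih _ (by omega)) (catalan_pos _).le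
          _ ≤ 2 * 4 ^ n := by
              rw [← sum_mul, Nat.sum_antidiagonal_eq_sum_range_succ_mk]
              gcongr
              exact sum_catalan_div_four_pow_le _
      have h1 : (r - 1) * (fixPoly n).eval r ≤ 2 * 4 ^ n :=
        mul_le_mul (by linarith) (ih n (by omega)) (eval_fixPoly_nonneg (by linarith) n) (by norm_num)
      rw [pow_succ]
      linarith

/-- For `2 < r < 3` the recurrence, read backwards, is a contraction. -/
lemma exists_eval_fixPoly_le_catalan {r : ℝ} (hr2 : 2 < r) (hr3 : r < 3) :
    ∃ B : ℝ, ∀ n, (fixPoly n).eval r ≤ B * catalan n := by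
  set D := (r - 1) ^ 2 - 4 * (r - 2) with hD
  have hDpos : 0 < D := by nlinarith [sq_pos_of_neg (show r - 3 < 0 by linarith)]
  have hP : 0 < (r - 1) ^ 2 := by nlinarith
  set ρ := 4 * (r - 2) / (r - 1) ^ 2 with hρ
  have hρ0 : 0 ≤ ρ := div_nonneg (by linarith) hP.le
  have hρ1 : ρ < 1 := by rw [hρ, div_lt_one hP]; linarith
  refine ⟨4 / D, fun n => ?_⟩
  have hrec (n : ℕ) : (r - 1) ^ 2 * (fixPoly n).eval r =
      catalan (n + 1) + (r - 2) * (fixPoly (n + 1)).eval r := by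
    have h := congrArg (Polynomial.eval r) (fixPoly_recurrences n).1
    simp only [Polynomial.eval_add, Polynomial.eval_mul, Polynomial.eval_sub, Polynomial.eval_X,
      Polynomial.eval_one, Polynomial.eval_pow, Polynomial.eval_natCast, Polynomial.eval_ofNat] at h
    linear_combination h
  have hstep (m : ℕ) : ∀ n, (fixPoly n).eval r ≤ 4 / D * catalan n + ρ ^ m * 4 ^ n := by
    induction m with
    | zero =>
      intro n
      have := eval_fixPoly_le_four_pow (by linarith) hr3.le n (r := r)
      have := catalan_pos n
      have : 0 ≤ 4 / D * catalan n := by positivity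
      linarith
    | succ m ih =>
      intro n
      refine le_of_mul_le_mul_left ?_ hP
      have h1 := mul_le_mul_of_nonneg_left (ih (n + 1)) (show 0 ≤ r - 2 by linarith)
      have h2 := catalan_succ_le n
      have h3 : (r - 1) ^ 2 * (4 / D) = 4 + 4 * (r - 2) * (4 / D) := by
        field_simp
        rw [hD]
        ring
      have h4 : (r - 1) ^ 2 * ρ = 4 * (r - 2) := by
        have hr : r - 1 ≠ 0 := by linarith
        rw [hρ]
        field_simp
      have h5 : 0 ≤ (r - 2) * (4 / D) := mul_nonneg (by linarith) (by positivity)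
      have h6 := mul_le_mul_of_nonneg_left h2 h5
      rw [hrec]
      calc _ ≤ 4 * (catalan n : ℝ) + ((r - 2) * (4 / D) * (4 * catalan n) +
            (r - 2) * (ρ ^ m * 4 ^ (n + 1))) := by linarith
        _ = _ := by
            rw [pow_succ, pow_succ]
            linear_combination -(catalan n : ℝ) * h3 - ρ ^ m * 4 ^ n * h4
  have hlim : Tendsto (fun m : ℕ => 4 / D * catalan n + ρ ^ m * 4 ^ n) atTop
      (𝓝 (4 / D * catalan n + 0 * 4 ^ n)) :=
    tendsto_const_nhds.add ((tendsto_pow_atTop_nhds_zero_of_lt_one hρ0 hρ1).mul_const _)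
  rw [zero_mul, add_zero] at hlim
  exact ge_of_tendsto' hlim fun m => hstep m n

/-- A perturbed linear recurrence with contracting ratio converges. -/
lemma tendsto_of_contracting_recurrence {t c w : ℕ → ℝ} {r L : ℝ} (hr : |r| < 1)
    (hc : Tendsto c atTop (𝓝 r)) (hw : Tendsto w atTop (𝓝 ((1 - r) * L)))
    (ht : ∀ n, t (n + 1) = c n * t n + w n) : Tendsto t atTop (𝓝 L) := by
  obtain ⟨ρ, hρr, hρ1⟩ := exists_between hr
  have hρ0 : 0 ≤ ρ := (abs_nonneg r).trans hρr.le
  have hv : Tendsto (fun n => w n - (1 - c n) * L) atTop (𝓝 0) := by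
    simpa using hw.sub ((hc.const_sub 1).mul_const L)
  rw [Metric.tendsto_atTop]
  intro ε hε
  have hev : ∀ᶠ n in atTop, |c n| < ρ ∧ |w n - (1 - c n) * L| < (1 - ρ) * (ε / 2) := by
    refine (hc.abs.eventually_lt_const hρr).and (hv.abs.eventually_lt_const ?_)
    rw [abs_zero]
    exact mul_pos (by linarith) (by linarith)
  obtain ⟨N, hN⟩ := eventually_atTop.1 hev
  have hbound (m : ℕ) : |t (N + m) - L| ≤ ρ ^ m * |t N - L| + ε / 2 := by
    induction m with
    | zero => simp; linarith
    | succ m ih =>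
      obtain ⟨h1, h2⟩ := hN (N + m) (by omega)
      have h3 : t (N + (m + 1)) - L =
          c (N + m) * (t (N + m) - L) + (w (N + m) - (1 - c (N + m)) * L) := by
        rw [← add_assoc, ht]
        ring
      have h4 : |c (N + m)| * |t (N + m) - L| ≤ ρ * (ρ ^ m * |t N - L| + ε / 2) :=
        mul_le_mul h1.le ih (abs_nonneg _) hρ0
      calc _ ≤ |c (N + m)| * |t (N + m) - L| + |w (N + m) - (1 - c (N + m)) * L| := by
            rw [h3, ← abs_mul]
            exact abs_add_le _ _
        _ ≤ _ := by
            rw [pow_succ]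
            linarith
  have hlim : Tendsto (fun m : ℕ => ρ ^ m * |t N - L|) atTop (𝓝 0) := by
    simpa using (tendsto_pow_atTop_nhds_zero_of_lt_one hρ0 hρ1).mul_const |t N - L|
  obtain ⟨M, hM⟩ := eventually_atTop.1 (hlim.eventually_lt_const (half_pos hε))
  refine ⟨N + M, fun n hn => ?_⟩
  obtain ⟨m, rfl⟩ := Nat.exists_eq_add_of_le (show N ≤ n by omega)
  rw [Real.dist_eq]
  linarith [hbound m, hM m (by omega)]

open Polynomial in
lemma coeff_fixPoly_succ (n k : ℕ) :
    2 * (fixPoly (n + 1)).coeff k - (X * fixPoly (n + 1)).coeff k + (fixPoly n).coeff k -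
      2 * (X * fixPoly n).coeff k + (X * (X * fixPoly n)).coeff k =
      if k = 0 then (catalan (n + 1) : ℝ) else 0 := by
  have h : 2 * fixPoly (n + 1) - X * fixPoly (n + 1) + fixPoly n - 2 * (X * fixPoly n) +
      X * (X * fixPoly n) = Polynomial.C (catalan (n + 1) : ℝ) := by
    rw [map_natCast]
    linear_combination (fixPoly_recurrences n).1
  have h' := congrArg (fun P => Polynomial.coeff P k) h
  simpa only [Polynomial.coeff_add, Polynomial.coeff_sub, Polynomial.coeff_ofNat_mul,
    Polynomial.coeff_C] using h'

/-- For fixed `k`, the proportion of `321`-avoiding permutations with `k` fixed points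
converges. -/
lemma tendsto_coeff_fixPoly_div_catalan (k : ℕ) :
    Tendsto (fun n => (fixPoly n).coeff k / (catalan n : ℝ)) atTop
      (𝓝 (4 / 9 * ((k + 1) * (1 / 3) ^ k))) := by
  induction k using Nat.strong_induction_on with
  | _ k ih =>
    have hrat := tendsto_catalan_ratio
    have hr : |(-1 / 8 : ℝ)| < 1 := by norm_num [abs_lt]
    have hc : Tendsto (fun n => -(1 / 2) * ((catalan n : ℝ) / catalan (n + 1))) atTop
        (𝓝 (-1 / 8)) := by
      convert hrat.const_mul (-(1 / 2)) using 2
      norm_num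
    have hne (n : ℕ) := (catalan_pos n).ne'
    match k, ih with
    | 0, _ =>
      refine tendsto_of_contracting_recurrence (w := fun _ => 1 / 2) hr hc ?_ fun n => ?_
      · convert tendsto_const_nhds using 2
        norm_num
      · have h := coeff_fixPoly_succ n 0
        simp only [Polynomial.coeff_X_mul_zero, if_true] at h
        have := hne n
        have := hne (n + 1)
        field_simp
        linear_combination h
    | 1, ih =>
      have h0 := ih 0 one_pos
      have h0' : Tendsto (fun n => (fixPoly (n + 1)).coeff 0 / (catalan (n + 1) : ℝ)) atTop _ :=
        h0.comp (tendsto_add_atTop_nat 1)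
      refine tendsto_of_contracting_recurrence (w := fun n =>
        1 / 2 * ((fixPoly (n + 1)).coeff 0 / (catalan (n + 1) : ℝ) + (catalan n : ℝ) /
          catalan (n + 1) * (2 * ((fixPoly n).coeff 0 / (catalan n : ℝ))))) hr hc ?_ fun n => ?_
      · convert (h0'.add (hrat.mul (h0.const_mul 2))).const_mul (1 / 2) using 2
        norm_num
      · have h := coeff_fixPoly_succ n 1
        have hX (P : Polynomial ℝ) : (Polynomial.X * P).coeff 1 = P.coeff 0 :=
          Polynomial.coeff_X_mul P 0
        simp only [hX, Polynomial.coeff_X_mul_zero, if_neg one_ne_zero] at h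
        have := hne n
        have := hne (n + 1)
        field_simp
        linear_combination h
    | k + 2, ih =>
      have h0 := ih k (by omega)
      have h1 := ih (k + 1) (by omega)
      have h1' : Tendsto (fun n => (fixPoly (n + 1)).coeff (k + 1) / (catalan (n + 1) : ℝ))
          atTop _ := h1.comp (tendsto_add_atTop_nat 1)
      refine tendsto_of_contracting_recurrence (w := fun n =>
        1 / 2 * ((fixPoly (n + 1)).coeff (k + 1) / (catalan (n + 1) : ℝ) + (catalan n : ℝ) /
          catalan (n + 1) * (2 * ((fixPoly n).coeff (k + 1) / (catalan n : ℝ)) -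
            (fixPoly n).coeff k / (catalan n : ℝ)))) hr hc ?_ fun n => ?_
      · convert (h1'.add (hrat.mul ((h1.const_mul 2).sub h0))).const_mul (1 / 2) using 2
        push_cast
        rw [pow_succ, pow_succ]
        ring
      · have h := coeff_fixPoly_succ n (k + 2)
        simp only [Polynomial.coeff_X_mul, if_neg (Nat.succ_ne_zero (k + 1))] at h
        have := hne n
        have := hne (n + 1)
        field_simp
        linear_combination h

lemma hasSum_coeff_fixPoly (n : ℕ) (q : ℝ) :
    HasSum (fun j => (fixPoly n).coeff j * q ^ j) ((fixPoly n).eval q) := by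
  rw [Polynomial.eval_eq_sum_range]
  refine hasSum_sum_of_ne_finset_zero fun j hj => ?_
  rw [Polynomial.coeff_eq_zero_of_natDegree_lt (by simpa using hj), zero_mul]

lemma coeff_mul_pow_le_eval_fixPoly {r : ℝ} (hr : 0 ≤ r) (n k : ℕ) :
    (fixPoly n).coeff k * r ^ k ≤ (fixPoly n).eval r :=
  le_hasSum (hasSum_coeff_fixPoly n r) k fun j _ => by
    rw [coeff_fixPoly]
    positivity

lemma tendsto_tsum_coeff_fixPoly_div_catalan {q : ℝ} (hq : 0 < q) (hq3 : q < 3) :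
    Tendsto (fun n => ∑' j, (fixPoly n).coeff j * q ^ j / (catalan n : ℝ)) atTop
      (𝓝 (4 / 9 * (1 / (1 - q / 3) ^ 2))) := by
  obtain ⟨r, hr, hr3⟩ := exists_between (max_lt hq3 (by norm_num : (2 : ℝ) < 3))
  obtain ⟨hqr, hr2⟩ := max_lt_iff.1 hr
  obtain ⟨B, hB⟩ := exists_eval_fixPoly_le_catalan hr2 hr3
  have hr0 : 0 < r := by linarith
  have hsum : HasSum (fun j : ℕ => 4 / 9 * (((j : ℝ) + 1) * (1 / 3) ^ j) * q ^ j)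
      (4 / 9 * (1 / (1 - q / 3) ^ 2)) := by
    have h := (hasSum_choose_mul_geometric_of_norm_lt_one (r := q / 3) 1
      (by rw [Real.norm_eq_abs, abs_lt]; constructor <;> linarith)).mul_left (4 / 9)
    refine (congrArg (HasSum · _) (funext fun j => ?_)).mpr h
    rw [Nat.choose_one_right, div_pow, div_pow]
    push_cast
    ring
  rw [← hsum.tsum_eq]
  refine tendsto_tsum_of_dominated_convergence (bound := fun j => B * (q / r) ^ j)
    ((summable_geometric_of_lt_one (by positivity) ((div_lt_one hr0).2 hqr)).mul_left B)
    (fun j => ?_) (Eventually.of_forall fun n j => ?_)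
  · convert (tendsto_coeff_fixPoly_div_catalan j).mul_const (q ^ j) using 2
    ring
  · have hc := catalan_pos n
    have h := (coeff_mul_pow_le_eval_fixPoly hr0.le n j).trans (hB n)
    have h0 : 0 ≤ (fixPoly n).coeff j := by
      rw [coeff_fixPoly]
      positivity
    rw [Real.norm_of_nonneg (by positivity), div_le_iff₀ hc, div_pow]
    have hrj : 0 < r ^ j := by positivity
    calc (fixPoly n).coeff j * q ^ j = (fixPoly n).coeff j * r ^ j * (q ^ j / r ^ j) := by
          field_simp
      _ ≤ B * catalan n * (q ^ j / r ^ j) := by gcongr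
      _ = _ := by ring

end Av321

/-- **Subcritical regime for fixed-point-biased `321`-avoiding permutations** (`0 < q < 3`):
under the Gibbs measure with weight `q` per fixed point, `X_n(q)` converges in distribution
to `NegBin(2, 1 - q/3)`: for every `k ≥ 0`,
`P(X_n(q) = k) → (k+1) (1-q/3)² (q/3)^k`. -/
theorem av321_fixed_points_subcritical (q : ℝ) (hq : 0 < q) (hq3 : q < 3) (k : ℕ) :
    Tendsto (fun n : ℕ =>
        ((av321FixedPointCount n k : ℝ) * q ^ k) /
          ∑' j : ℕ, (av321FixedPointCount n j : ℝ) * q ^ j) atTop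
      (𝓝 ((k + 1 : ℝ) * (1 - q / 3) ^ 2 * (q / 3) ^ k)) := by
  have hnum := (Av321.tendsto_coeff_fixPoly_div_catalan k).mul_const (q ^ k)
  have hden := Av321.tendsto_tsum_coeff_fixPoly_div_catalan hq hq3
  have hq' : 1 - q / 3 ≠ 0 := by linarith
  have hlim := hnum.div hden (by positivity)
  have hval : 4 / 9 * (((k : ℝ) + 1) * (1 / 3) ^ k) * q ^ k / (4 / 9 * (1 / (1 - q / 3) ^ 2)) =
      (k + 1) * (1 - q / 3) ^ 2 * (q / 3) ^ k := by
    rw [div_pow, div_pow, one_pow]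
    field_simp
  rw [hval] at hlim
  refine hlim.congr fun n => ?_
  have hc := (Av321.catalan_pos n).ne'
  simp only [Pi.div_apply, tsum_div_const, Av321.coeff_fixPoly]
  rw [div_mul_eq_mul_div, div_div_div_cancel_right₀ hc]
end

section
/- Critical regime for fixed-point-biased 321-avoiding permutations: at q = 3, for every real x ≥ 0, lim_{n→∞} P( (2/3)·X_n(3)/√n ≤ x ) = 1 − e^{−x²/4}; that is, (2/3)·X_n(3)/√n converges in distribution to the Rayleigh distribution R(√2). -/
open Filter Topology

open Classical in
/-- The arrangements of a finite set `S` of naturals: the lists in which every element of `S`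
occurs exactly once. -/
noncomputable def arrangements (S : Finset ℕ) : Finset (List ℕ) := S.val.lists.toFinset

lemma mem_arrangements {S : Finset ℕ} {l : List ℕ} :
    l ∈ arrangements S ↔ S.val = (l : Multiset ℕ) := by
  simp [arrangements, Multiset.mem_lists_iff]

lemma mem_of_mem_arrangements {S : Finset ℕ} {l : List ℕ} (h : l ∈ arrangements S) (a : ℕ) :
    a ∈ l ↔ a ∈ S := by
  rw [mem_arrangements] at h
  rw [← Finset.mem_val, h, Multiset.mem_coe]

lemma arrangements_empty : arrangements ∅ = {[]} := by
  ext l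
  rw [mem_arrangements]
  simp [eq_comm]

lemma cons_mem_arrangements {S : Finset ℕ} {a : ℕ} {l : List ℕ} :
    a :: l ∈ arrangements S ↔ a ∈ S ∧ l ∈ arrangements (S.erase a) := by
  simp only [mem_arrangements, ← Multiset.cons_coe, Finset.erase_val]
  constructor
  · intro h
    exact ⟨by rw [← Finset.mem_val, h]; simp, by rw [h]; simp⟩
  · rintro ⟨ha, h⟩
    rw [← h, Multiset.cons_erase ha]

/-- Sums over arrangements can be organised by the first entry. -/
lemma sum_arrangements_filter {S : Finset ℕ} (hS : S.Nonempty) (p : List ℕ → Prop)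
    [DecidablePred p] (g : List ℕ → ℝ) :
    ∑ l ∈ arrangements S with p l, g l =
      ∑ a ∈ S, ∑ l ∈ arrangements (S.erase a) with p (a :: l), g (a :: l) := by
  rw [Finset.sum_sigma']
  symm
  refine Finset.sum_bij (fun x _ => x.1 :: x.2) ?_ ?_ ?_ ?_
  · rintro ⟨a, l⟩ h
    simp only [Finset.mem_sigma, Finset.mem_filter] at h ⊢
    exact ⟨cons_mem_arrangements.2 ⟨h.1, h.2.1⟩, h.2.2⟩
  · rintro ⟨a, l⟩ _ ⟨b, m⟩ _ h
    simp only [List.cons.injEq] at h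
    obtain ⟨rfl, rfl⟩ := h
    rfl
  · intro l h
    cases l with
    | nil =>
      obtain ⟨a, ha⟩ := hS
      have := (mem_of_mem_arrangements (Finset.mem_filter.1 h).1 a).2 ha
      simp at this
    | cons a l =>
      simp only [Finset.mem_filter, cons_mem_arrangements] at h
      exact ⟨⟨a, l⟩, by simp only [Finset.mem_sigma, Finset.mem_filter]; tauto, rfl⟩
  · intros
    rfl

/-- A list avoids the pattern `321`. -/
def ListAvoids321 (l : List ℕ) : Prop := l.Triplewise fun a b c => ¬ (c < b ∧ b < a)

/-- Prepending `M` to a list forbids descents among the entries below `M`. If the next entry `a`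
exceeds `M`, it takes over this role. -/
lemma listAvoids321_cons_cons_of_lt {M a : ℕ} {l : List ℕ} (h : M < a) :
    ListAvoids321 (M :: a :: l) ↔ ListAvoids321 (a :: l) := by
  simp only [ListAvoids321, List.triplewise_cons, List.pairwise_cons]
  refine ⟨And.right, fun h' => ⟨⟨fun _ _ => by omega, h'.1.imp ?_⟩, h'⟩⟩
  intros
  omega

lemma listAvoids321_cons_cons_of_gt {M a : ℕ} {l : List ℕ} (hl : ∀ b ∈ l, a < b) :
    ListAvoids321 (M :: a :: l) ↔ ListAvoids321 (M :: l) := by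
  simp only [ListAvoids321, List.triplewise_cons, List.pairwise_cons]
  refine ⟨fun h => ⟨h.1.2, h.2.2⟩, fun h' => ⟨⟨fun b hb => ?_, h'.1⟩, ?_, h'.2⟩⟩
  · have := hl b hb
    omega
  · refine List.Pairwise.imp_of_mem (R := fun _ _ => True) ?_ (List.pairwise_of_forall (by simp))
    intro b c hb hc _
    have := hl b hb
    omega

lemma not_listAvoids321_cons_cons {M a b : ℕ} {l : List ℕ} (h : a < M) (hb : b ∈ l)
    (hba : b < a) : ¬ ListAvoids321 (M :: a :: l) := by
  simp only [ListAvoids321, List.triplewise_cons, List.pairwise_cons]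
  intro h'
  exact h'.1.1 b hb ⟨hba, h⟩

/-- The number of fixed points of a list whose first entry stands at position `i`. -/
def listFixedPoints : ℕ → List ℕ → ℕ
  | _, [] => 0
  | i, a :: l => (if a = i then 1 else 0) + listFixedPoints (i + 1) l

/-- The weight `3 ^ f` of an object with `f` fixed points, cut off below `K`. -/
noncomputable def tailWeight (K f : ℕ) : ℝ := if K ≤ f then 3 ^ f else 0

lemma tailWeight_one_add (K f : ℕ) : tailWeight K (1 + f) = 3 * tailWeight (K - 1) f := by
  unfold tailWeight
  by_cases h : K ≤ 1 + f
  · rw [if_pos h, if_pos (by omega)]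
    ring
  · rw [if_neg h, if_neg (by omega)]
    ring

/-- Ballot-type numbers, the coefficients of `C(x) ^ (h + 1) / √(1 - 4 x)`. -/
noncomputable def ballot (h r : ℕ) : ℝ := ((2 * r + h + 1).choose r : ℝ)

lemma ballot_zero (h : ℕ) : ballot h 0 = 1 := by simp [ballot]

lemma ballot_succ (h r : ℕ) : ballot (h + 1) (r + 1) = ballot h (r + 1) + ballot (h + 2) r := by
  unfold ballot
  rw [show 2 * (r + 1) + (h + 1) + 1 = (2 * r + h + 3) + 1 by ring, Nat.choose_succ_succ,
    show 2 * (r + 1) + h + 1 = 2 * r + h + 3 by ring,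
    show 2 * r + (h + 2) + 1 = 2 * r + h + 3 by ring]
  push_cast
  ring

/-- The closed form of the weighted count of arrangements with at least `K` fixed points, where
`h` values are pending below the current maximum and `r` values lie above it. -/
noncomputable def tailSum (K h r : ℕ) : ℝ :=
  3 ^ K * ∑ m ∈ Finset.range (r + 1),
    if K + 2 * m ≤ r then ((K + m - 1).choose m : ℝ) * ballot (2 * m + h) (r - K - 2 * m) else 0

lemma tailSum_eq_range {K h r N : ℕ} (hN : r ≤ 2 * N + 1) :
    tailSum K h r = 3 ^ K * ∑ m ∈ Finset.range (N + 1),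
      if K + 2 * m ≤ r then ((K + m - 1).choose m : ℝ) * ballot (2 * m + h) (r - K - 2 * m)
      else 0 := by
  unfold tailSum
  congr 1
  rcases le_total N r with h | h
  · symm
    refine Finset.sum_subset (by intro m; simp; omega) fun m _ hm => if_neg ?_
    simp at hm
    omega
  · refine Finset.sum_subset (by intro m; simp; omega) fun m _ hm => if_neg ?_
    simp at hm
    omega

lemma tailSum_succ_zero (K h : ℕ) : tailSum K (h + 1) 0 = tailSum K h 0 := by
  unfold tailSum
  congr 1
  refine Finset.sum_congr rfl fun m _ => ?_
  split_ifs with hm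
  · simp [ballot_zero]
  · rfl

lemma tailSum_succ_succ (K h r : ℕ) :
    tailSum K (h + 1) (r + 1) = tailSum K h (r + 1) + tailSum K (h + 2) r := by
  rw [tailSum_eq_range (r := r) (N := r + 1) (by omega)]
  unfold tailSum
  rw [← mul_add, ← Finset.sum_add_distrib]
  congr 1
  refine Finset.sum_congr rfl fun m _ => ?_
  rcases lt_trichotomy (K + 2 * m) (r + 1) with h1 | h1 | h1
  · rw [if_pos (by omega), if_pos (by omega), if_pos (by omega),
      show r + 1 - K - 2 * m = (r - K - 2 * m) + 1 by omega, ← add_assoc, ← add_assoc,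
      ballot_succ]
    ring
  · rw [if_pos (by omega), if_pos (by omega), if_neg (by omega),
      show r + 1 - K - 2 * m = 0 by omega, ballot_zero, ballot_zero, add_zero]
  · rw [if_neg (by omega), if_neg (by omega), if_neg (by omega), add_zero]

/-- The convolution of `tailSum` arising from the choice of the next maximum. -/
lemma sum_tailSum (K h r : ℕ) :
    ∑ s ∈ Finset.range (r + 1), tailSum K (h + s) (r - s) = tailSum K (h + 1) r := by
  induction r generalizing h with
  | zero => simp [tailSum_succ_zero]
  | succ r ih =>
    rw [Finset.sum_range_succ', tailSum_succ_succ, ← ih (h + 1), add_comm]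
    congr 1
    refine Finset.sum_congr rfl fun s _ => ?_
    congr 1 <;> omega

lemma tailSum_zero_left (h r : ℕ) : tailSum 0 h r = ballot h r := by
  unfold tailSum
  rw [Finset.sum_eq_single 0]
  · simp
  · intro m _ hm
    rw [Nat.choose_eq_zero_of_lt (by omega)]
    simp
  · simp

lemma tailSum_zero_one (K : ℕ) : tailSum K 0 1 = 3 * tailSum (K - 1) 0 0 := by
  rcases K with _ | _ | K
  · norm_num [tailSum_zero_left, ballot]
  · norm_num [tailSum, Finset.sum_range_succ, ballot]
  · norm_num [tailSum, Finset.sum_range_succ]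

lemma tailSum_zero_add_two (K r : ℕ) :
    tailSum K 0 (r + 2) = 3 * tailSum (K - 1) 0 (r + 1) + tailSum K 2 r := by
  cases K with
  | zero =>
    simp only [tailSum_zero_left, ballot, Nat.zero_sub]
    have e : (2 * r + 3).choose (r + 2) = (2 * r + 3).choose (r + 1) := by
      rw [Nat.choose_symm_of_eq_add]; omega
    rw [show 2 * (r + 2) + 0 + 1 = (2 * r + 3) + 2 by ring,
      show 2 * (r + 1) + 0 + 1 = 2 * r + 3 by ring, show 2 * r + 2 + 1 = 2 * r + 3 by ring,
      Nat.choose_succ_succ' (2 * r + 3 + 1) (r + 1), Nat.choose_succ_succ' (2 * r + 3) (r + 1),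
      Nat.choose_succ_succ' (2 * r + 3) r, e]
    push_cast
    ring
  | succ K =>
    rw [Nat.add_sub_cancel, tailSum_eq_range (r := r + 1) (N := r + 2) (by omega)]
    rw [tailSum_eq_range (r := r) (N := r + 1) (by omega)]
    unfold tailSum
    rw [Finset.sum_range_succ' _ (r + 2), Finset.sum_range_succ' _ (r + 2), pow_succ,
      mul_comm _ (3 : ℝ), mul_assoc, mul_assoc, ← mul_add, ← mul_add]
    congr 2
    refine Eq.trans ?_ (add_right_comm _ _ _)
    rw [← Finset.sum_add_distrib]
    congr 1
    · refine Finset.sum_congr rfl fun m _ => ?_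
      by_cases h1 : K + 1 + 2 * m ≤ r
      · rw [if_pos (by omega), if_pos (by omega), if_pos (by omega),
          show K + 1 + (m + 1) - 1 = (K + m) + 1 by omega, Nat.choose_succ_succ,
          show K + (m + 1) - 1 = K + m by omega, show K + 1 + m - 1 = K + m by omega,
          show r + 2 - (K + 1) - 2 * (m + 1) = r - (K + 1) - 2 * m by omega,
          show r + 1 - K - 2 * (m + 1) = r - (K + 1) - 2 * m by omega]
        simp only [mul_add, mul_one, add_zero]
        push_cast
        ring
      · rw [if_neg (by omega), if_neg (by omega), if_neg (by omega), add_zero]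
    · simp

/-- The contribution of the arrangements whose first entry is a new maximum `M + 1 + s`. -/
lemma sum_range_first_max (K h r i M : ℕ) (hi : i + h = M + 1)
    (hr : 0 < h + r) :
    ∑ s ∈ Finset.range r,
      (if M + 1 + s = i then 3 * tailSum (K - 1) (h + s) (r - 1 - s)
        else tailSum K (h + s) (r - 1 - s)) +
      (if h = 0 then 0 else tailSum K (h - 1) r) = tailSum K h r := by
  cases h with
  | succ h =>
    rw [if_neg (by omega), Nat.add_sub_cancel]
    cases r with
    | zero => simp [tailSum_succ_zero]
    | succ r =>
      rw [tailSum_succ_succ, ← sum_tailSum K (h + 1) r, add_comm]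
      congr 1
      refine Finset.sum_congr rfl fun s _ => ?_
      rw [if_neg (by omega), Nat.add_sub_cancel]
  | zero =>
    rw [if_pos rfl, add_zero]
    match r with
    | 0 => omega
    | 1 => simp [tailSum_zero_one, show M + 1 = i by omega]
    | r + 2 =>
      rw [tailSum_zero_add_two, ← sum_tailSum K 1 r, Finset.sum_range_succ', add_comm]
      congr 1
      · rw [if_pos (by omega)]
        simp
      · refine Finset.sum_congr rfl fun s _ => ?_
        rw [if_neg (by omega)]
        congr 1 <;> omega

open Classical in
/-- The weighted count of the completions of a partial `321`-avoiding arrangement: `A` is the set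
of pending values below the current maximum `M`, and the `r` values above `M` are all unused. -/
theorem sum_completions (K n : ℕ) (A : Finset ℕ) (M r i : ℕ) (hn : A.card + r = n)
    (hA : ∀ a ∈ A, 0 < a ∧ a < M) (hi : i + A.card = M + 1) :
    ∑ l ∈ arrangements (A ∪ Finset.Ico (M + 1) (M + 1 + r)) with ListAvoids321 (M :: l),
      tailWeight K (listFixedPoints i l) = tailSum K A.card r := by
  induction n generalizing K A M r i with
  | zero =>
    obtain rfl : A = ∅ := Finset.card_eq_zero.1 (by omega)
    obtain rfl : r = 0 := by omega
    simp only [add_zero, Finset.Ico_self, Finset.union_empty, arrangements_empty,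
      Finset.card_empty]
    rw [Finset.filter_true_of_mem (by simp [ListAvoids321])]
    rcases K with _ | K <;> simp [tailWeight, listFixedPoints, tailSum, ballot_zero]
  | succ n ih =>
    have hdisj : Disjoint A (Finset.Ico (M + 1) (M + 1 + r)) := by
      rw [Finset.disjoint_left]
      intro a ha
      have := hA a ha
      simp
      omega
    have hne : (A ∪ Finset.Ico (M + 1) (M + 1 + r)).Nonempty := by
      rw [← Finset.card_pos, Finset.card_union_of_disjoint hdisj, Nat.card_Ico]
      omega
    rw [sum_arrangements_filter hne, Finset.sum_union hdisj, add_comm,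
      ← sum_range_first_max K A.card r i M hi (by omega), Finset.sum_Ico_eq_sum_range,
      Nat.add_sub_cancel_left]
    congr 1
    · refine Finset.sum_congr rfl fun s hs => ?_
      rw [Finset.mem_range] at hs
      have herase : (A ∪ Finset.Ico (M + 1) (M + 1 + r)).erase (M + 1 + s) =
          (A ∪ Finset.Ico (M + 1) (M + 1 + s)) ∪
            Finset.Ico (M + 1 + s + 1) (M + 1 + s + 1 + (r - 1 - s)) := by
        ext b
        have : b ∈ A → b < M := fun hb => (hA b hb).2
        simp only [Finset.mem_erase, Finset.mem_union, Finset.mem_Ico]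
        by_cases hb : b ∈ A
        · simp only [hb, true_or, and_true, iff_true]
          have := this hb
          omega
        · simp only [hb, false_or]
          omega
      have hcard : (A ∪ Finset.Ico (M + 1) (M + 1 + s)).card = A.card + s := by
        rw [Finset.card_union_of_disjoint, Nat.card_Ico, Nat.add_sub_cancel_left]
        exact hdisj.mono_right (Finset.Ico_subset_Ico_right (by omega))
      have hA' : ∀ a ∈ A ∪ Finset.Ico (M + 1) (M + 1 + s), 0 < a ∧ a < M + 1 + s := by
        intro a ha
        rw [Finset.mem_union, Finset.mem_Ico] at ha
        rcases ha with ha | ha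
        · have := hA a ha
          omega
        · omega
      have ih' := fun K' => ih K' _ (M + 1 + s) (r - 1 - s) (i + 1) (by rw [hcard]; omega) hA'
        (by rw [hcard]; omega)
      rw [hcard] at ih'
      rw [herase]
      simp only [listAvoids321_cons_cons_of_lt (show M < M + 1 + s by omega), listFixedPoints]
      split_ifs with h
      · simp only [tailWeight_one_add, ← Finset.mul_sum, ih']
      · simp only [zero_add, ih']
    · split_ifs with h
      · rw [Finset.card_eq_zero.1 h, Finset.sum_empty]
      · have hAne : A.Nonempty := Finset.card_pos.1 (by omega)
        have hmin := A.min'_mem hAne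
        rw [Finset.sum_eq_single_of_mem _ hmin]
        · have hlt := hA _ hmin
          set a := A.min' hAne with ha
          have hcard := Finset.card_erase_of_mem hmin
          have herase : (A ∪ Finset.Ico (M + 1) (M + 1 + r)).erase a =
              A.erase a ∪ Finset.Ico (M + 1) (M + 1 + r) := by
            rw [Finset.erase_union_distrib, Finset.erase_eq_of_notMem (s := Finset.Ico _ _)]
            simp
            omega
          have hai : a < i := by
            have : A ⊆ Finset.Ico a M := fun b hb =>
              Finset.mem_Ico.2 ⟨A.min'_le b hb, (hA b hb).2⟩
            have := Finset.card_le_card this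
            rw [Nat.card_Ico] at this
            omega
          rw [herase, ← hcard, ← ih K (A.erase a) M r (i + 1) (by omega)
            (fun b hb => hA b (Finset.mem_of_mem_erase hb)) (by omega)]
          refine Finset.sum_congr (Finset.filter_congr fun l hl => ?_) fun l _ => ?_
          · refine listAvoids321_cons_cons_of_gt fun b hb => ?_
            rw [mem_of_mem_arrangements hl, Finset.mem_union, Finset.mem_Ico] at hb
            rcases hb with hb | hb
            · exact A.min'_lt_of_mem_erase_min' hAne hb
            · omega
          · rw [listFixedPoints, if_neg hai.ne, zero_add]
        · intro a ha hne
          refine Finset.sum_eq_zero fun l hl => ?_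
          rw [Finset.mem_filter] at hl
          refine absurd hl.2 (not_listAvoids321_cons_cons (hA a ha).2 (b := A.min' hAne) ?_
            (lt_of_le_of_ne (A.min'_le a ha) hne.symm))
          rw [mem_of_mem_arrangements hl.1]
          exact Finset.mem_erase.2 ⟨hne.symm, Finset.mem_union_left _ hmin⟩

open Classical in
lemma sum_listAvoids321 (K n : ℕ) :
    ∑ l ∈ arrangements (Finset.Icc 1 n) with ListAvoids321 l,
      tailWeight K (listFixedPoints 1 l) = tailSum K 0 n := by
  have h := sum_completions K n ∅ 0 n 1 (by simp) (by simp) (by simp)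
  rw [Finset.empty_union, Finset.card_empty, zero_add] at h
  rw [← h]
  refine Finset.sum_congr ?_ fun _ _ => rfl
  have : Finset.Icc 1 n = Finset.Ico 1 (1 + n) := by
    ext
    simp
    omega
  rw [this]
  refine Finset.filter_congr fun l _ => ?_
  simp only [ListAvoids321, List.triplewise_cons]
  refine (and_iff_right (List.pairwise_of_forall ?_)).symm
  omega

lemma listFixedPoints_ofFn {n : ℕ} (i : ℕ) (f : Fin n → ℕ) :
    listFixedPoints i (List.ofFn f) = (Finset.univ.filter fun j : Fin n => f j = i + j).card := by
  induction n generalizing i with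
  | zero => simp [listFixedPoints]
  | succ n ih =>
    rw [List.ofFn_succ, listFixedPoints, ih, Fin.card_filter_univ_succ]
    simp only [Fin.val_zero, add_zero, Fin.val_succ, add_assoc, add_comm 1]
    split_ifs <;> simp [add_comm]

lemma listAvoids321_ofFn {n : ℕ} (σ : Equiv.Perm (Fin n)) :
    ListAvoids321 (List.ofFn fun i => (σ i : ℕ) + 1) ↔ Avoids321 σ := by
  rw [ListAvoids321, List.triplewise_iff_getElem, Avoids321]
  simp only [List.getElem_ofFn, List.length_ofFn]
  constructor
  · rintro h ⟨i, j, k, hij, hjk, h1, h2⟩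
    exact h i j k hij hjk k.2 ⟨by simpa using h1, by simpa using h2⟩
  · intro h i j k hij hjk hk h'
    exact h ⟨⟨i, by omega⟩, ⟨j, by omega⟩, ⟨k, hk⟩, hij, hjk, by simpa using h'⟩

/-- Every arrangement of `{1,…,n}` is the one-line notation of a permutation. -/
lemma exists_perm_of_mem_arrangements {n : ℕ} {l : List ℕ}
    (hl : l ∈ arrangements (Finset.Icc 1 n)) :
    ∃ σ : Equiv.Perm (Fin n), List.ofFn (fun i => (σ i : ℕ) + 1) = l := by
  have hmem := mem_of_mem_arrangements hl
  rw [mem_arrangements] at hl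
  have hnodup : l.Nodup := by
    rw [← Multiset.coe_nodup, ← hl]
    exact Finset.nodup _
  have hlen : l.length = n := by
    rw [← Multiset.coe_card, ← hl, Finset.card_val, Nat.card_Icc, Nat.add_sub_cancel]
  subst hlen
  have hb : ∀ i : Fin l.length, 1 ≤ l[i] ∧ l[i] ≤ l.length := fun i =>
    Finset.mem_Icc.1 ((hmem _).1 (List.getElem_mem i.2))
  let f : Fin l.length → Fin l.length := fun i => ⟨l[i] - 1, by have := hb i; omega⟩
  have hf : Function.Injective f := by
    intro i j hij
    have h1 := hb i
    have h2 := hb j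
    have h3 : l[i] - 1 = l[j] - 1 := congrArg Fin.val hij
    have h4 : l[(i : ℕ)] = l[(j : ℕ)] := by
      simp only [Fin.getElem_fin] at h1 h2 h3
      omega
    exact Fin.ext ((hnodup.getElem_inj_iff).1 h4)
  refine ⟨Equiv.ofBijective f (Finite.injective_iff_bijective.1 hf), ?_⟩
  refine List.ext_getElem (by simp) fun i h1 h2 => ?_
  have := hb ⟨i, h2⟩
  simp only [Fin.getElem_fin] at this
  simp [f]
  omega

lemma ofFn_mem_arrangements {n : ℕ} (σ : Equiv.Perm (Fin n)) :
    List.ofFn (fun i => (σ i : ℕ) + 1) ∈ arrangements (Finset.Icc 1 n) := by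
  have hinj : Function.Injective fun i => (σ i : ℕ) + 1 := by
    intro i j h
    simpa [Fin.val_inj] using h
  have hnodup : (List.ofFn fun i => (σ i : ℕ) + 1).Nodup := List.nodup_ofFn.2 hinj
  rw [mem_arrangements]
  have : Finset.Icc 1 n = ⟨_, Multiset.coe_nodup.2 hnodup⟩ := by
    symm
    refine Finset.eq_of_subset_of_card_le ?_ (by simp)
    intro a
    simp only [Finset.mem_mk, Multiset.mem_coe, List.mem_ofFn, Finset.mem_Icc]
    rintro ⟨i, rfl⟩
    have := (σ i).2
    omega
  rw [this]

open Classical in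
/-- Sums against the fixed point distribution are sums over `321`-avoiding permutations. -/
lemma tsum_av321FixedPointCount (n : ℕ) (g : ℕ → ℝ) :
    ∑' k : ℕ, (av321FixedPointCount n k : ℝ) * g k =
      ∑ l ∈ arrangements (Finset.Icc 1 n) with ListAvoids321 l, g (listFixedPoints 1 l) := by
  have hcount : ∀ k, av321FixedPointCount n k = (Finset.univ.filter fun σ : Equiv.Perm (Fin n) =>
      Avoids321 σ ∧ (Finset.univ.filter fun i => σ i = i).card = k).card := by
    intro k
    rw [av321FixedPointCount, Nat.card_eq_fintype_card, Fintype.card_subtype]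
  have hperm : ∑ σ : Equiv.Perm (Fin n) with Avoids321 σ,
      g (Finset.univ.filter fun i => σ i = i).card =
      ∑ l ∈ arrangements (Finset.Icc 1 n) with ListAvoids321 l, g (listFixedPoints 1 l) := by
    refine Finset.sum_bij (fun σ _ => List.ofFn fun i => (σ i : ℕ) + 1) ?_ ?_ ?_ ?_
    · intro σ hσ
      rw [Finset.mem_filter] at hσ ⊢
      exact ⟨ofFn_mem_arrangements σ, (listAvoids321_ofFn σ).2 hσ.2⟩
    · intro σ _ τ _ h
      ext i
      simpa using congrFun (List.ofFn_injective h) i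
    · intro l hl
      rw [Finset.mem_filter] at hl
      obtain ⟨σ, rfl⟩ := exists_perm_of_mem_arrangements hl.1
      exact ⟨σ, by simpa using (listAvoids321_ofFn σ).1 hl.2, rfl⟩
    · intro σ _
      rw [listFixedPoints_ofFn]
      congr! 3
      rw [Fin.ext_iff]
      omega
  rw [← hperm, tsum_eq_sum (s := Finset.range (n + 1)), ← Finset.sum_fiberwise_of_maps_to
    (t := Finset.range (n + 1)) (g := fun σ : Equiv.Perm (Fin n) =>
      (Finset.univ.filter fun i => σ i = i).card)]
  · refine Finset.sum_congr rfl fun k _ => ?_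
    rw [Finset.filter_filter, Finset.sum_congr rfl (g := fun _ => g k), Finset.sum_const,
      nsmul_eq_mul, hcount]
    intro σ hσ
    rw [(Finset.mem_filter.1 hσ).2.2]
  · intro σ _
    rw [Finset.mem_range, Nat.lt_succ_iff]
    simpa using Finset.card_filter_le (Finset.univ : Finset (Fin n)) fun i => σ i = i
  · intro k hk
    rw [hcount, Finset.card_eq_zero.2, Nat.cast_zero, zero_mul]
    refine Finset.filter_eq_empty_iff.2 fun σ _ h => hk ?_
    rw [Finset.mem_range, Nat.lt_succ_iff, ← h.2]
    simpa using Finset.card_filter_le (Finset.univ : Finset (Fin n)) fun i => σ i = i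

/-- The total weight of fixed point numbers at least `K`. -/
lemma tsum_tailWeight (n K : ℕ) :
    ∑' k : ℕ, (av321FixedPointCount n k : ℝ) * tailWeight K k = tailSum K 0 n := by
  classical
  rw [tsum_av321FixedPointCount, ← sum_listAvoids321]

lemma tsum_weight (n : ℕ) :
    ∑' k : ℕ, (av321FixedPointCount n k : ℝ) * 3 ^ k = ballot 0 n := by
  rw [← tailSum_zero_left, ← tsum_tailWeight]
  simp [tailWeight]

lemma tsum_lower_weight (n K : ℕ) :
    ∑' k : ℕ, (av321FixedPointCount n k : ℝ) * (if k < K then 3 ^ k else 0) =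
      ballot 0 n - tailSum K 0 n := by
  classical
  rw [← tsum_weight, ← tsum_tailWeight, tsum_av321FixedPointCount, tsum_av321FixedPointCount,
    tsum_av321FixedPointCount, ← Finset.sum_sub_distrib]
  refine Finset.sum_congr rfl fun l _ => ?_
  unfold tailWeight
  split_ifs <;> first | omega | simp

/-- The negative binomial weights with success probability `3 / 4` and `k + 1` successes. -/
noncomputable def negBinomial (k m : ℕ) : ℝ := (3 / 4) ^ (k + 1) * ((m + k).choose k * (1 / 4) ^ m)

lemma negBinomial_nonneg (k m : ℕ) : 0 ≤ negBinomial k m := by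
  unfold negBinomial
  positivity

lemma hasSum_negBinomial (k : ℕ) : HasSum (negBinomial k) 1 := by
  have h := (hasSum_choose_mul_geometric_of_norm_lt_one k (r := (1 / 4 : ℝ))
    (by norm_num)).mul_left ((3 / 4) ^ (k + 1))
  have e : (3 / 4 : ℝ) ^ (k + 1) * (1 / (1 - 1 / 4) ^ (k + 1)) = 1 := by
    rw [mul_one_div, show (1 - 1 / 4 : ℝ) = 3 / 4 by norm_num, div_self (by positivity)]
  rwa [e] at h

lemma succ_mul_negBinomial_succ (k m : ℕ) :
    ((m + 1 : ℕ) : ℝ) * negBinomial k (m + 1) = (k + 1) / 3 * negBinomial (k + 1) m := by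
  have h := Nat.choose_succ_right_eq (m + 1 + k) k
  rw [show m + 1 + k - k = m + 1 by omega] at h
  have h' : ((m + 1 + k).choose (k + 1) : ℝ) * (k + 1) =
      (m + 1 + k).choose k * ((m + 1 : ℕ) : ℝ) := by
    exact_mod_cast h
  unfold negBinomial
  rw [show m + (k + 1) = m + 1 + k by ring, pow_succ (3 / 4 : ℝ) (k + 1), pow_succ (1 / 4 : ℝ) m]
  linear_combination (-(3 / 4 : ℝ) ^ (k + 1) * (1 / 4) ^ m * (1 / 4)) * h'

lemma hasSum_mul_negBinomial (k : ℕ) :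
    HasSum (fun m : ℕ => (m : ℝ) * negBinomial k m) ((k + 1) / 3) := by
  rw [← hasSum_nat_add_iff' 1]
  simp only [succ_mul_negBinomial_succ, Finset.sum_range_one, Nat.cast_zero, zero_mul, sub_zero]
  simpa using (hasSum_negBinomial (k + 1)).mul_left (((k : ℝ) + 1) / 3)

lemma hasSum_mul_sub_one_mul_negBinomial (k : ℕ) :
    HasSum (fun m : ℕ => ((m : ℝ) - 1) * (m * negBinomial k m)) ((k + 1) * (k + 2) / 9) := by
  rw [← hasSum_nat_add_iff' 1]
  simp only [succ_mul_negBinomial_succ, Finset.sum_range_one, Nat.cast_zero, zero_mul, sub_zero,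
    mul_zero]
  have h := (hasSum_mul_negBinomial (k + 1)).mul_left (((k : ℝ) + 1) / 3)
  rw [show ((k : ℝ) + 1) * (k + 2) / 9 = (k + 1) / 3 * (((k + 1 : ℕ) + 1) / 3) by push_cast; ring]
  refine h.congr_fun fun m => ?_
  push_cast
  ring

/-- The variance of the negative binomial distribution. -/
lemma hasSum_sq_mul_negBinomial (k : ℕ) :
    HasSum (fun m : ℕ => ((m : ℝ) - ((k : ℝ) + 1) / 3) ^ 2 * negBinomial k m)
      (4 * ((k : ℝ) + 1) / 9) := by
  have h := ((hasSum_mul_sub_one_mul_negBinomial k).add ((hasSum_mul_negBinomial k).mul_left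
    (1 - 2 * (((k : ℝ) + 1) / 3)))).add
      ((hasSum_negBinomial k).mul_left (((k : ℝ) + 1) / 3 * (((k : ℝ) + 1) / 3)))
  rw [show 4 * ((k : ℝ) + 1) / 9 = (k + 1) * (k + 2) / 9 + (1 - 2 * ((k + 1) / 3)) * ((k + 1) / 3) +
    (k + 1) / 3 * ((k + 1) / 3) * 1 by ring]
  refine h.congr_fun fun m => ?_
  ring

/-- The normalised total weight. -/
noncomputable def scaledBallot (N : ℕ) : ℝ := ballot 0 N / 4 ^ N

lemma ballot_pos (h r : ℕ) : 0 < ballot h r := by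
  unfold ballot
  exact_mod_cast Nat.choose_pos (by omega)

lemma scaledBallot_pos (N : ℕ) : 0 < scaledBallot N := div_pos (ballot_pos 0 N) (by positivity)

lemma scaledBallot_succ (N : ℕ) :
    scaledBallot (N + 1) = scaledBallot N * ((2 * N + 3) / (2 * N + 4)) := by
  have h1 := Nat.add_one_mul_choose_eq (2 * N + 2) N
  have h2 := Nat.choose_mul_succ_eq (2 * N + 1) N
  rw [show 2 * N + 1 + 1 - N = N + 2 by omega] at h2
  have h1' : ((2 * N + 2 : ℕ) + 1 : ℝ) * (2 * N + 2).choose N =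
      (2 * N + 2 + 1).choose (N + 1) * (N + 1) := by exact_mod_cast h1
  have h2' : ((2 * N + 1).choose N : ℝ) * (2 * N + 1 + 1) = (2 * N + 1 + 1).choose N * (N + 2) := by
    exact_mod_cast h2
  have h3 : ballot 0 (N + 1) * (N + 2) = 2 * (2 * N + 3) * ballot 0 N := by
    unfold ballot
    rw [show 2 * (N + 1) + 0 + 1 = 2 * N + 2 + 1 by ring, add_zero]
    have hN : (N + 1 : ℝ) ≠ 0 := by positivity
    apply mul_left_cancel₀ hN
    push_cast at h1'
    linear_combination (-(N + 2 : ℝ)) * h1' - (2 * N + 3 : ℝ) * h2'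
  unfold scaledBallot
  rw [pow_succ]
  field_simp
  linear_combination 2 * h3

lemma scaledBallot_antitone : Antitone scaledBallot := by
  refine antitone_nat_of_succ_le fun N => ?_
  rw [scaledBallot_succ]
  refine mul_le_of_le_one_right (scaledBallot_pos N).le ?_
  rw [div_le_one (by positivity)]
  linarith

lemma monotone_sq_scaledBallot_mul : Monotone fun N => scaledBallot N ^ 2 * (N + 1) := by
  refine monotone_nat_of_le_succ fun N => ?_
  rw [scaledBallot_succ, mul_pow, mul_assoc]
  refine mul_le_mul_of_nonneg_left ?_ (sq_nonneg _)
  rw [div_pow, div_mul_eq_mul_div, le_div_iff₀ (by positivity)]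
  push_cast
  nlinarith

/-- The ratio of a binomial coefficient to the central one. -/
noncomputable def centralRatio (N m : ℕ) : ℝ :=
  ((2 * N + 1).choose (N - m) : ℝ) / (2 * N + 1).choose N

lemma centralRatio_zero (N : ℕ) : centralRatio N 0 = 1 := by
  unfold centralRatio
  rw [Nat.sub_zero, div_self]
  exact_mod_cast (Nat.choose_pos (by omega)).ne'

lemma centralRatio_succ {N m : ℕ} (h : m < N) :
    centralRatio N (m + 1) = centralRatio N m * ((N - m) / (N + 2 + m)) := by
  have h1 := Nat.choose_succ_right_eq (2 * N + 1) (N - (m + 1))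
  rw [show N - (m + 1) + 1 = N - m by omega,
    show 2 * N + 1 - (N - (m + 1)) = N + 2 + m by omega] at h1
  have h2 : ((2 * N + 1).choose (N - m) : ℝ) * (N - m) =
      (2 * N + 1).choose (N - (m + 1)) * (N + 2 + m) := by
    rw [← Nat.cast_sub h.le]
    exact_mod_cast h1
  unfold centralRatio
  rw [div_mul_div_comm, h2]
  field_simp

lemma centralRatio_le {N m j : ℕ} (hj : j ≤ m) (hm : m ≤ N) :
    centralRatio N j ≤ Real.exp (-(j * (j + 1) / (N + 1 + m))) := by
  induction j with
  | zero => simp [centralRatio_zero]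
  | succ j ih =>
    have hjN : (j + 1 : ℝ) ≤ N := by exact_mod_cast hj.trans hm
    have hjm : (j + 1 : ℝ) ≤ m := by exact_mod_cast hj
    rw [centralRatio_succ (by omega)]
    have e : Real.exp (-(((j + 1 : ℕ) : ℝ) * ((j + 1 : ℕ) + 1) / (N + 1 + m))) =
        Real.exp (-(j * (j + 1) / (N + 1 + m))) * Real.exp (-(2 * (j + 1) / (N + 1 + m))) := by
      rw [← Real.exp_add]
      push_cast
      ring_nf
    rw [e]
    refine mul_le_mul (ih (by omega)) ?_ (div_nonneg (by linarith) (by positivity))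
      (Real.exp_pos _).le
    calc ((N : ℝ) - j) / (N + 2 + j) = -(2 * (j + 1) / (N + 2 + j)) + 1 := by
          field_simp
          ring
      _ ≤ Real.exp (-(2 * (j + 1) / (N + 2 + j))) := Real.add_one_le_exp _
      _ ≤ _ := by
          gcongr Real.exp (-?_)
          refine div_le_div_of_nonneg_left (by positivity) (by positivity) (by linarith)

lemma le_centralRatio {N m j : ℕ} (hj : j ≤ m) (hm : m ≤ N) :
    Real.exp (-(j * (j + 1) / (N + 1 - m))) ≤ centralRatio N j := by
  induction j with
  | zero => simp [centralRatio_zero]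
  | succ j ih =>
    have hjm : (j + 1 : ℝ) ≤ m := by exact_mod_cast hj
    have hmN : (m : ℝ) ≤ N := by exact_mod_cast hm
    have hpos : 0 < (N : ℝ) - j := by linarith
    have hpos' : 0 < (N : ℝ) + 1 - m := by linarith
    rw [centralRatio_succ (by omega)]
    have e : Real.exp (-(((j + 1 : ℕ) : ℝ) * ((j + 1 : ℕ) + 1) / (N + 1 - m))) =
        Real.exp (-(j * (j + 1) / (N + 1 - m))) * Real.exp (-(2 * (j + 1) / (N + 1 - m))) := by
      rw [← Real.exp_add]
      push_cast
      ring_nf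
    rw [e]
    refine mul_le_mul (ih (by omega)) ?_ (Real.exp_pos _).le (by unfold centralRatio; positivity)
    rw [Real.exp_neg,
      show ((N : ℝ) - j) / (N + 2 + j) = (((N : ℝ) + 2 + j) / (N - j))⁻¹ by rw [inv_div]]
    refine inv_anti₀ (by positivity) ?_
    calc ((N : ℝ) + 2 + j) / (N - j) = 2 * (j + 1) / (N - j) + 1 := by
          field_simp
          ring
      _ ≤ Real.exp (2 * (j + 1) / (N - j)) := Real.add_one_le_exp _
      _ ≤ _ := by
          refine Real.exp_le_exp.2 (div_le_div_of_nonneg_left (by positivity) hpos' (by linarith))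

/-- The ratio by which the tail probability deviates from the negative binomial total mass. -/
noncomputable def tailRatio (n k m : ℕ) : ℝ :=
  if k + 1 + 2 * m ≤ n then
    scaledBallot (n - k - 1 - m) / scaledBallot n * centralRatio (n - k - 1 - m) m
  else 0

lemma hasSum_tailRatio (n k : ℕ) :
    HasSum (fun m => negBinomial k m * tailRatio n k m) (tailSum (k + 1) 0 n / ballot 0 n) := by
  have h : tailSum (k + 1) 0 n / ballot 0 n =
      ∑ m ∈ Finset.range (n + 1), negBinomial k m * tailRatio n k m := by
    unfold tailSum
    rw [mul_div_right_comm, Finset.mul_sum]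
    refine Finset.sum_congr rfl fun m _ => ?_
    unfold tailRatio
    split_ifs with hm
    · obtain ⟨N, rfl⟩ : ∃ N, n = N + (k + 1 + m) := ⟨n - (k + 1 + m), by omega⟩
      have e1 : N + (k + 1 + m) - k - 1 - m = N := by omega
      have e2 : N + (k + 1 + m) - (k + 1) - 2 * m = N - m := by omega
      have e3 : ballot (2 * m + 0) (N - m) = ((2 * N + 1).choose (N - m) : ℝ) := by
        unfold ballot
        congr 2
        omega
      have e4 : (k + 1 + m - 1).choose m = (m + k).choose k := by
        rw [show k + 1 + m - 1 = m + k by omega, Nat.choose_symm_of_eq_add rfl]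
      have e5 : ((2 * N + 1).choose N : ℝ) = ballot 0 N := by simp [ballot]
      have := (ballot_pos 0 N).ne'
      have := (ballot_pos 0 (N + (k + 1 + m))).ne'
      rw [e1, e2, e3, e4, negBinomial, scaledBallot, scaledBallot, centralRatio, e5, pow_add 4 N,
        pow_add 4 (k + 1), div_pow, div_pow, one_pow]
      field_simp
    · simp
  rw [h]
  refine hasSum_sum_of_ne_finset_zero fun m hm => ?_
  rw [Finset.mem_range] at hm
  rw [tailRatio, if_neg (by omega), mul_zero]

lemma scaledBallot_div_le {N n : ℕ} (h : N ≤ n) :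
    scaledBallot N / scaledBallot n ≤ √((n + 1) / (N + 1)) := by
  have h1 := monotone_sq_scaledBallot_mul h
  have := scaledBallot_pos n
  refine Real.le_sqrt_of_sq_le ?_
  rw [div_pow, div_le_div_iff₀ (by positivity) (by positivity)]
  linarith

lemma one_le_scaledBallot_div {N n : ℕ} (h : N ≤ n) : 1 ≤ scaledBallot N / scaledBallot n := by
  rw [one_le_div (scaledBallot_pos n)]
  exact scaledBallot_antitone h

lemma tailRatio_nonneg (n k m : ℕ) : 0 ≤ tailRatio n k m := by
  unfold tailRatio
  split_ifs
  · exact mul_nonneg (div_nonneg (scaledBallot_pos _).le (scaledBallot_pos _).le)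
      (by unfold centralRatio; positivity)
  · rfl

lemma tailRatio_le {n k m : ℕ} (h : k + 1 + 2 * m ≤ n) : tailRatio n k m ≤
    √((n + 1) / (n - k - m)) * Real.exp (-(m * (m + 1) / (n - k))) := by
  rw [tailRatio, if_pos h]
  have h1 := scaledBallot_div_le (show n - k - 1 - m ≤ n by omega)
  have h2 := centralRatio_le (le_refl m) (show m ≤ n - k - 1 - m by omega)
  have e : ((n - k - 1 - m : ℕ) : ℝ) = n - k - 1 - m := by
    rw [Nat.cast_sub (by omega), Nat.cast_sub (by omega), Nat.cast_sub (by omega), Nat.cast_one]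
  rw [e] at h1 h2
  refine (mul_le_mul h1 h2 (by unfold centralRatio; positivity) (Real.sqrt_nonneg _)).trans_eq ?_
  congr 3 <;> ring

lemma le_tailRatio {n k m : ℕ} (h : k + 1 + 2 * m ≤ n) :
    Real.exp (-(m * (m + 1) / (n - k - 2 * m))) ≤ tailRatio n k m := by
  rw [tailRatio, if_pos h]
  have h1 := one_le_scaledBallot_div (show n - k - 1 - m ≤ n by omega)
  have h2 := le_centralRatio (le_refl m) (show m ≤ n - k - 1 - m by omega)
  have e : ((n - k - 1 - m : ℕ) : ℝ) = n - k - 1 - m := by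
    rw [Nat.cast_sub (by omega), Nat.cast_sub (by omega), Nat.cast_sub (by omega), Nat.cast_one]
  rw [e, show (n - k - 1 - m + 1 - m : ℝ) = n - k - 2 * m by ring] at h2
  exact h2.trans (le_mul_of_one_le_left (by unfold centralRatio; positivity) h1)

/-- Pairs `(n, m)` with `n → ∞` and `m / √n → a`. -/
noncomputable def scaledFilter (a : ℝ) : Filter (ℕ × ℕ) :=
  comap Prod.fst atTop ⊓ comap (fun p : ℕ × ℕ => (p.2 : ℝ) / √(p.1 : ℝ)) (𝓝 a)

lemma tendsto_fst_scaledFilter (a : ℝ) : Tendsto Prod.fst (scaledFilter a) atTop :=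
  tendsto_comap.mono_left inf_le_left

lemma tendsto_div_sqrt_scaledFilter (a : ℝ) :
    Tendsto (fun p : ℕ × ℕ => (p.2 : ℝ) / √(p.1 : ℝ)) (scaledFilter a) (𝓝 a) :=
  tendsto_comap.mono_left inf_le_right

lemma tendsto_inv_sqrt_natCast : Tendsto (fun n : ℕ => (√(n : ℝ))⁻¹) atTop (𝓝 0) :=
  (Real.tendsto_sqrt_atTop.comp tendsto_natCast_atTop_atTop).inv_tendsto_atTop

lemma tendsto_tailRatio {k : ℕ → ℕ} {c : ℝ}
    (hk : Tendsto (fun n : ℕ => (k n : ℝ) / √(n : ℝ)) atTop (𝓝 c)) (a : ℝ) :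
    Tendsto (fun p : ℕ × ℕ => tailRatio p.1 (k p.1) p.2) (scaledFilter a)
      (𝓝 (Real.exp (-a ^ 2))) := by
  have hn := tendsto_fst_scaledFilter a
  have hy := tendsto_div_sqrt_scaledFilter a
  have hz := hk.comp hn
  have hu := tendsto_inv_sqrt_natCast.comp hn
  have hpos : ∀ᶠ p : ℕ × ℕ in scaledFilter a, 0 < p.1 := hn.eventually_gt_atTop 0
  simp only [Function.comp_def] at hz hu
  have hm : Tendsto (fun p : ℕ × ℕ => (p.2 : ℝ) / p.1) (scaledFilter a) (𝓝 0) := by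
    have := hy.mul hu
    rw [mul_zero] at this
    refine this.congr' ?_
    filter_upwards [hpos] with p hp
    rw [← div_eq_mul_inv, div_div, Real.mul_self_sqrt (Nat.cast_nonneg _)]
  have hkn : Tendsto (fun p : ℕ × ℕ => (k p.1 : ℝ) / p.1) (scaledFilter a) (𝓝 0) := by
    have := hz.mul hu
    rw [mul_zero] at this
    refine this.congr' ?_
    filter_upwards [hpos] with p hp
    rw [← div_eq_mul_inv, div_div, Real.mul_self_sqrt (Nat.cast_nonneg _)]
  have hone : Tendsto (fun p : ℕ × ℕ => 1 / (p.1 : ℝ)) (scaledFilter a) (𝓝 0) :=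
    tendsto_one_div_atTop_nhds_zero_nat.comp hn
  have hsq : Tendsto (fun p : ℕ × ℕ => (p.2 : ℝ) * (p.2 + 1) / p.1) (scaledFilter a)
      (𝓝 (a ^ 2)) := by
    have := (hy.mul hy).add hm
    rw [add_zero, ← sq] at this
    refine this.congr' ?_
    filter_upwards [hpos] with p hp
    rw [div_mul_div_comm, Real.mul_self_sqrt (Nat.cast_nonneg _), ← add_div, mul_add, mul_one]
  have hsmall : ∀ᶠ p : ℕ × ℕ in scaledFilter a, k p.1 + 1 + 2 * p.2 ≤ p.1 := by
    have := (hkn.add hone).add (hm.const_mul 2)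
    rw [mul_zero, add_zero, add_zero] at this
    filter_upwards [hpos, this.eventually_lt_const (zero_lt_one)] with p hp h
    have hp' : (0 : ℝ) < p.1 := by exact_mod_cast hp
    rw [← mul_div_assoc, ← add_div, ← add_div, div_lt_one hp'] at h
    exact_mod_cast h.le
  have hlow : Tendsto (fun p : ℕ × ℕ =>
      Real.exp (-((p.2 : ℝ) * (p.2 + 1) / (p.1 - k p.1 - 2 * p.2)))) (scaledFilter a)
      (𝓝 (Real.exp (-a ^ 2))) := by
    refine (Real.continuous_exp.tendsto _).comp (Tendsto.neg ?_)
    have h1 : Tendsto (fun p : ℕ × ℕ => 1 - (k p.1 : ℝ) / p.1 - 2 * ((p.2 : ℝ) / p.1))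
        (scaledFilter a) (𝓝 1) := by
      simpa using (hkn.const_sub 1).sub (hm.const_mul 2)
    have := hsq.div h1 one_ne_zero
    rw [div_one] at this
    refine this.congr' ?_
    filter_upwards [hpos] with p hp
    have hp' : (p.1 : ℝ) ≠ 0 := by exact_mod_cast hp.ne'
    rw [show (p.1 : ℝ) - k p.1 - 2 * p.2 =
      p.1 * (1 - (k p.1 : ℝ) / p.1 - 2 * ((p.2 : ℝ) / p.1)) by field_simp, div_mul_eq_div_div]
    rfl
  have hupp : Tendsto (fun p : ℕ × ℕ => √(((p.1 : ℝ) + 1) / (p.1 - k p.1 - p.2)) *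
      Real.exp (-((p.2 : ℝ) * (p.2 + 1) / (p.1 - k p.1)))) (scaledFilter a)
      (𝓝 (Real.exp (-a ^ 2))) := by
    rw [show Real.exp (-a ^ 2) = √((1 + 0) / (1 - 0 - 0)) * Real.exp (-(a ^ 2 / (1 - 0))) by simp]
    refine Tendsto.mul ((Real.continuous_sqrt.tendsto _).comp ?_)
      ((Real.continuous_exp.tendsto _).comp (Tendsto.neg ?_))
    · refine ((hone.const_add 1).div ((hkn.const_sub 1).sub hm) (by norm_num)).congr' ?_
      filter_upwards [hpos] with p hp
      have hp' : (p.1 : ℝ) ≠ 0 := by exact_mod_cast hp.ne'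
      simp only [Pi.div_apply]
      rw [show (p.1 : ℝ) + 1 = p.1 * (1 + 1 / p.1) by field_simp,
        show (p.1 : ℝ) - k p.1 - p.2 = p.1 * (1 - (k p.1 : ℝ) / p.1 - (p.2 : ℝ) / p.1) by
          field_simp,
        mul_div_mul_left _ _ hp']
    · refine (hsq.div (hkn.const_sub 1) (by norm_num)).congr' ?_
      filter_upwards [hpos] with p hp
      have hp' : (p.1 : ℝ) ≠ 0 := by exact_mod_cast hp.ne'
      simp only [Pi.div_apply]
      rw [show (p.1 : ℝ) - k p.1 = p.1 * (1 - (k p.1 : ℝ) / p.1) by field_simp,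
        div_mul_eq_div_div]
  refine tendsto_of_tendsto_of_tendsto_of_le_of_le' hlow hupp ?_ ?_
  · filter_upwards [hsmall] with p hp using le_tailRatio hp
  · filter_upwards [hsmall] with p hp using tailRatio_le hp

lemma tailRatio_le_sqrt (n k m : ℕ) : tailRatio n k m ≤ √(n + 1) := by
  by_cases h : k + 1 + 2 * m ≤ n
  · have h' : (k : ℝ) + 1 + 2 * m ≤ n := by exact_mod_cast h
    have hm : (0 : ℝ) ≤ m := Nat.cast_nonneg m
    refine (tailRatio_le h).trans ?_
    refine (mul_le_of_le_one_right (Real.sqrt_nonneg _) ?_).trans ?_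
    · rw [Real.exp_le_one_iff, neg_nonpos]
      exact div_nonneg (by positivity) (by linarith)
    · exact Real.sqrt_le_sqrt (div_le_self (by positivity) (by linarith))
  · rw [tailRatio, if_neg h]
    positivity

lemma tailRatio_le_two {n k m : ℕ} (hk : 4 * (k + 1) ≤ n) (hm : 4 * m ≤ n) :
    tailRatio n k m ≤ 2 := by
  have h : k + 1 + 2 * m ≤ n := by omega
  have hk' : 4 * ((k : ℝ) + 1) ≤ n := by exact_mod_cast hk
  have hm' : 4 * (m : ℝ) ≤ n := by exact_mod_cast hm
  have hm0 : (0 : ℝ) ≤ m := Nat.cast_nonneg m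
  have hk0 : (0 : ℝ) ≤ k := Nat.cast_nonneg k
  refine (tailRatio_le h).trans ?_
  refine (mul_le_of_le_one_right (Real.sqrt_nonneg _) ?_).trans ?_
  · rw [Real.exp_le_one_iff, neg_nonpos]
    exact div_nonneg (by positivity) (by linarith)
  · refine Real.sqrt_le_iff.2 ⟨by norm_num, ?_⟩
    rw [div_le_iff₀ (by linarith)]
    linarith

/-- The rescaled tail sums converge to the Rayleigh tail. -/
lemma tendsto_tailSum_div {k : ℕ → ℕ} {c : ℝ}
    (hk : Tendsto (fun n : ℕ => (k n : ℝ) / √(n : ℝ)) atTop (𝓝 c)) :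
    Tendsto (fun n => tailSum (k n + 1) 0 n / ballot 0 n) atTop
      (𝓝 (Real.exp (-(c / 3) ^ 2))) := by
  set L := Real.exp (-(c / 3) ^ 2) with hL
  have hL0 : 0 ≤ L := (Real.exp_pos _).le
  have hL1 : L ≤ 1 := by
    rw [hL, Real.exp_le_one_iff]
    nlinarith [sq_nonneg (c / 3)]
  have hinv := tendsto_inv_sqrt_natCast
  have hμ : Tendsto (fun n : ℕ => ((k n : ℝ) + 1) / 3 / √(n : ℝ)) atTop (𝓝 (c / 3)) := by
    have := (hk.add hinv).div_const 3
    rw [add_zero] at this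
    refine this.congr fun n => ?_
    ring
  have hμn : Tendsto (fun n : ℕ => ((k n : ℝ) + 1) / n) atTop (𝓝 0) := by
    have := (hμ.mul hinv).const_mul 3
    rw [mul_zero, mul_zero] at this
    refine this.congr fun n => ?_
    rw [← div_eq_mul_inv, div_div, Real.mul_self_sqrt (Nat.cast_nonneg _)]
    ring
  rw [Metric.tendsto_nhds]
  intro ε hε
  have hgood := (tendsto_tailRatio hk (c / 3)).eventually (Metric.ball_mem_nhds _ (half_pos hε))
  rw [scaledFilter, Filter.eventually_inf] at hgood
  obtain ⟨s, hs, t, ht, hst⟩ := hgood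
  rw [Filter.mem_comap] at hs ht
  obtain ⟨s', hs', hss⟩ := hs
  obtain ⟨t', ht', htt⟩ := ht
  obtain ⟨δ, hδ, hball⟩ := Metric.mem_nhds_iff.1 ht'
  set C := 8 / δ ^ 2 + 1 with hC
  have hCpos : 0 < C := by positivity
  have hbound : Tendsto (fun n : ℕ => ε / 2 + C * (4 / 9 * (((k n : ℝ) + 1) / n))) atTop
      (𝓝 (ε / 2)) := by
    simpa using ((hμn.const_mul (4 / 9)).const_mul C).const_add (ε / 2)
  filter_upwards [hs', hbound.eventually_lt_const (half_lt_self hε), eventually_ge_atTop 100000,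
    hμn.eventually_lt_const (show (0 : ℝ) < 1 / 4 by norm_num),
    hμ.eventually (Metric.ball_mem_nhds _ (half_pos hδ))] with n hns hnε hn hkn hnμ
  set μ := ((k n : ℝ) + 1) / 3 with hμdef
  have hn0 : (100000 : ℝ) ≤ n := by exact_mod_cast hn
  have hnpos : (0 : ℝ) < n := by linarith
  have hsqrt : 0 < √(n : ℝ) := Real.sqrt_pos.2 hnpos
  have hsq : √(n : ℝ) ^ 2 = n := Real.sq_sqrt hnpos.le
  rw [div_lt_iff₀ hnpos] at hkn
  have hk4 : 4 * (k n + 1) ≤ n := by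
    have : 4 * ((k n : ℝ) + 1) ≤ n := by linarith
    exact_mod_cast this
  have hpt : ∀ m : ℕ, ‖negBinomial (k n) m * tailRatio n (k n) m - L * negBinomial (k n) m‖ ≤
      ε / 2 * negBinomial (k n) m + C / n * (((m : ℝ) - μ) ^ 2 * negBinomial (k n) m) := by
    intro m
    have hw := negBinomial_nonneg (k n) m
    have hR := tailRatio_nonneg n (k n) m
    rw [mul_comm, ← sub_mul, norm_mul, Real.norm_of_nonneg hw, ← mul_assoc, ← add_mul]
    refine mul_le_mul_of_nonneg_right ?_ hw
    by_cases hm : |(m : ℝ) - μ| < δ / 2 * √(n : ℝ)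
    · have h1 : (n, m) ∈ s ∩ t := by
        refine ⟨hss hns, htt (hball ?_)⟩
        have h2 : |(m : ℝ) / √(n : ℝ) - μ / √(n : ℝ)| < δ / 2 := by
          rw [← sub_div, abs_div, abs_of_pos hsqrt, div_lt_iff₀ hsqrt]
          exact hm
        have h3 := abs_sub_le ((m : ℝ) / √(n : ℝ)) (μ / √(n : ℝ)) (c / 3)
        rw [Real.dist_eq] at hnμ
        rw [Metric.mem_ball, Real.dist_eq]
        linarith
      have h2 := hst _ h1
      rw [Real.dist_eq] at h2
      rw [Real.norm_eq_abs]
      have : 0 ≤ C / n * ((m : ℝ) - μ) ^ 2 := by positivity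
      linarith
    · rw [not_lt] at hm
      have hsqm : δ ^ 2 / 4 * n ≤ ((m : ℝ) - μ) ^ 2 := by
        rw [← hsq, ← sq_abs ((m : ℝ) - μ)]
        calc δ ^ 2 / 4 * √(n : ℝ) ^ 2 = (δ / 2 * √(n : ℝ)) ^ 2 := by ring
          _ ≤ _ := pow_le_pow_left₀ (by positivity) hm 2
      have hsplit : C / n * ((m : ℝ) - μ) ^ 2 =
          8 / δ ^ 2 * (((m : ℝ) - μ) ^ 2 / n) + ((m : ℝ) - μ) ^ 2 / n := by
        rw [hC]
        ring
      rw [hsplit, Real.norm_eq_abs, abs_le]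
      have hq : 0 ≤ ((m : ℝ) - μ) ^ 2 / n := by positivity
      have hq2 : 2 ≤ 8 / δ ^ 2 * (((m : ℝ) - μ) ^ 2 / n) := by
        rw [← div_le_iff₀' (by positivity), le_div_iff₀ hnpos]
        refine le_trans (le_of_eq ?_) hsqm
        field_simp
        norm_num
      refine ⟨by linarith, ?_⟩
      by_cases hm4 : 4 * m ≤ n
      · have := tailRatio_le_two hk4 hm4
        linarith
      · have h1 := tailRatio_le_sqrt n (k n) m
        have h2 : (n : ℝ) ≤ 4 * m := by exact_mod_cast (not_le.1 hm4).le
        have h3 : (n : ℝ) / 8 ≤ m - μ := by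
          rw [hμdef]
          linarith
        have h4 : (n : ℝ) / 64 ≤ ((m : ℝ) - μ) ^ 2 / n := by
          rw [le_div_iff₀ hnpos]
          nlinarith
        have h5 : √((n : ℝ) + 1) ≤ n / 64 := by
          refine Real.sqrt_le_iff.2 ⟨by positivity, ?_⟩
          nlinarith
        linarith
  have hsum := (hasSum_tailRatio n (k n)).sub ((hasSum_negBinomial (k n)).mul_left L)
  have hdom := ((hasSum_negBinomial (k n)).mul_left (ε / 2)).add
    ((hasSum_sq_mul_negBinomial (k n)).mul_left (C / n))
  have := hsum.norm_le_of_bounded hdom hpt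
  rw [mul_one, mul_one, ← dist_eq_norm] at this
  refine this.trans_lt (lt_of_eq_of_lt ?_ hnε)
  ring

/-- **Critical regime for fixed-point-biased `321`-avoiding permutations** (`q = 3`):
under the Gibbs measure with weight `3` per fixed point, `(2/3) X_n(3)/√n` converges in
distribution to the Rayleigh distribution `R(√2)`: for every `x ≥ 0`,
`P((2/3) X_n(3)/√n ≤ x) → 1 - e^{-x²/4}`. -/
theorem av321_fixed_points_critical (x : ℝ) (hx : 0 ≤ x) :
    Tendsto (fun n : ℕ =>
        (∑' k : ℕ, if (2 / 3 : ℝ) * (k : ℝ) / Real.sqrt n ≤ x then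
            (av321FixedPointCount n k : ℝ) * 3 ^ k else 0) /
          ∑' j : ℕ, (av321FixedPointCount n j : ℝ) * 3 ^ j) atTop
      (𝓝 (1 - Real.exp (-x ^ 2 / 4))) := by
  have hk : Tendsto (fun n : ℕ => (⌊3 / 2 * x * √(n : ℝ)⌋₊ : ℝ) / √(n : ℝ)) atTop
      (𝓝 (3 / 2 * x)) :=
    (tendsto_nat_floor_mul_div_atTop (by positivity)).comp
      (Real.tendsto_sqrt_atTop.comp tendsto_natCast_atTop_atTop)
  have h := (tendsto_tailSum_div hk).const_sub 1
  rw [show -(3 / 2 * x / 3) ^ 2 = -x ^ 2 / 4 by ring] at h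
  refine h.congr' ?_
  filter_upwards [eventually_gt_atTop 0] with n hn
  have hsqrt : 0 < √(n : ℝ) := Real.sqrt_pos.2 (by exact_mod_cast hn)
  have hiff : ∀ k : ℕ, (2 / 3 : ℝ) * k / √(n : ℝ) ≤ x ↔ k < ⌊3 / 2 * x * √(n : ℝ)⌋₊ + 1 := by
    intro k
    rw [Nat.lt_succ_iff, Nat.le_floor_iff (by positivity), div_le_iff₀ hsqrt]
    constructor <;> intro h <;> linarith
  have hnum : (∑' k : ℕ, if (2 / 3 : ℝ) * (k : ℝ) / √(n : ℝ) ≤ x then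
      (av321FixedPointCount n k : ℝ) * 3 ^ k else 0) =
      ballot 0 n - tailSum (⌊3 / 2 * x * √(n : ℝ)⌋₊ + 1) 0 n := by
    rw [← tsum_lower_weight]
    refine tsum_congr fun k => ?_
    simp only [hiff, mul_ite, mul_zero]
  rw [hnum, tsum_weight, sub_div, div_self (ballot_pos 0 n).ne']
end
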